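/- arXiv:1307.1160 — 4 statements merged into one kernel-verified Lean document; each statement's English description precedes it below -/
import Mathlib

section
/- Let d ≤ m be positive integers and let A = A_1 ∪ … ∪ A_l be an infinite subset of ℝ^m, where each A_i is a compact set contained in some d-dimensional C^1-manifold embedded in ℝ^m and H_d(A_i ∩ A_j) = 0 for all 1 ≤ i < j ≤ l. If H_d(A) = 0, then M^d_N(A)/(N ln N) → ∞ as N → ∞. -/
open MeasureTheory Filter Set Metric
open scoped ENNReal NNReal Topology

noncomputable section

/-- `ℝ^m` as Euclidean space. -/
abbrev Euc (m : ℕ) : Type := EuclideanSpace ℝ (Fin m)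

/-- `β_d`: the (`H_d`-)volume of the `d`-dimensional unit ball. -/
def unitBallVol (d : ℕ) : ℝ≥0∞ := volume (Metric.ball (0 : Euc d) 1)

/-- The Riesz `s`-polarization `M^s(ω_N; A)` of a configuration `ω : Fin N → ℝ^m`
relative to a set `A`: `min_{y ∈ A} Σ_i |y - x_i|^{-s}` (valued in `ℝ≥0∞`,
with `|y - x_i|^{-s} = ∞` when `y = x_i`). -/
def polarization {m N : ℕ} (ω : Fin N → Euc m) (A : Set (Euc m)) (s : ℝ) : ℝ≥0∞ :=
  ⨅ y ∈ A, ∑ i, edist y (ω i) ^ (-s)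

/-- The `N`-point Riesz `s`-polarization constant `M^s_N(A)`. -/
def polarizationConst (m : ℕ) (A : Set (Euc m)) (s : ℝ) (N : ℕ) : ℝ≥0∞ :=
  ⨆ (ω : Fin N → Euc m) (_ : ∀ i, ω i ∈ A), polarization ω A s

/-- `W ⊆ ℝ^m` is a `d`-dimensional `C¹`-manifold embedded in `ℝ^m`: every point of `W`
has a relatively open neighborhood `V` homeomorphic to an open set `U ⊆ ℝ^d` via a
`C¹`-map `f : U → V` whose Jacobian has rank `d` at every point of `U`. -/
def IsC1EmbeddedManifold (d m : ℕ) (W : Set (Euc m)) : Prop :=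
  ∀ y ∈ W, ∃ (V : Set (Euc m)) (U : Set (Euc d)) (f : Euc d → Euc m) (g : Euc m → Euc d),
    y ∈ V ∧ (∃ O : Set (Euc m), IsOpen O ∧ V = O ∩ W) ∧ IsOpen U ∧
    Set.BijOn f U V ∧ ContDiffOn ℝ 1 f U ∧ ContinuousOn g V ∧ Set.LeftInvOn g f U ∧
    ∀ x ∈ U, LinearMap.rank (fderiv ℝ f x).toLinearMap = d

/-- `ᾱ_d(A; ε) = sup_{0 < r ≤ ε} sup_{x ∈ A} H_d(B(x,r) ∩ A) / (β_d r^d)`. -/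
def alphaBar {m : ℕ} (d : ℕ) (A : Set (Euc m)) (ε : ℝ) : ℝ≥0∞ :=
  ⨆ (r : ℝ) (_ : r ∈ Set.Ioc (0:ℝ) ε) (x : Euc m) (_ : x ∈ A),
    μH[(d:ℝ)] (Metric.closedBall x r ∩ A) / (unitBallVol d * ENNReal.ofReal (r ^ d))

/-- `lim_{ε→0⁺} ᾱ_d(A; ε)`; since `ᾱ_d(A; ·)` is nondecreasing, the one-sided limit
exists and equals the infimum over `ε > 0`. -/
def alphaLim {m : ℕ} (d : ℕ) (A : Set (Euc m)) : ℝ≥0∞ :=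
  ⨅ (ε : ℝ) (_ : 0 < ε), alphaBar d A ε

/-- The normalized counting measure `(1/N) Σ_{i=1}^N δ_{x_i}` of a configuration. -/
def countingMeasure {m N : ℕ} (ω : Fin N → Euc m) : Measure (Euc m) :=
  (N : ℝ≥0∞)⁻¹ • ∑ i, Measure.dirac (ω i)

/-- The boundary `∂_A K` of `K` relative to `A`. -/
def relBoundary {m : ℕ} (A K : Set (Euc m)) : Set (Euc m) :=
  A ∩ closure K ∩ closure (A \ K)

/-- The Riesz `s`-energy `E_s(X_N) = Σ_{j ≠ k} |x_j - x_k|^{-s}`. -/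
def rieszEnergy {m N : ℕ} (x : Fin N → Euc m) (s : ℝ) : ℝ≥0∞ :=
  ∑ j, ∑ k, if j ≠ k then edist (x j) (x k) ^ (-s) else 0

/-- The minimum `N`-point Riesz `s`-energy `𝓔_s(A, N)` of `A` (over configurations of
`N` pairwise distinct points of `A`). -/
def minEnergy (m : ℕ) (A : Set (Euc m)) (s : ℝ) (N : ℕ) : ℝ≥0∞ :=
  ⨅ (x : Fin N → Euc m) (_ : (∀ i, x i ∈ A) ∧ Function.Injective x), rieszEnergy x s

/-- `B` is bi-Lipschitz homeomorphic to `D` with constant `M`. -/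
def IsBiLipschitzHomeoWith {X Y : Type*} [PseudoMetricSpace X] [PseudoMetricSpace Y]
    (M : ℝ) (B : Set X) (D : Set Y) : Prop :=
  ∃ φ : X → Y, φ '' B = D ∧ ∀ x ∈ B, ∀ y ∈ B,
    M⁻¹ * dist x y ≤ dist (φ x) (φ y) ∧ dist (φ x) (φ y) ≤ M * dist x y

/-- The distance `dist(C, D) = inf {|x - y| : x ∈ C, y ∈ D}` between two sets
(as an extended nonnegative real). -/
def setEDist {X : Type*} [PseudoEMetricSpace X] (C D : Set X) : ℝ≥0∞ :=
  ⨅ (x ∈ C) (y ∈ D), edist x y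

/-- A set `A` has zero `d`-dimensional Minkowski content: for all small `r`, it can be partitioned
into `n` pieces of diameter at most `r`, with `n * r ^ d` arbitrarily small. The partition is given
by a labelling `q` of the points by natural numbers below `n`. -/
def HasZeroMinkowskiContent {X : Type*} [PseudoMetricSpace X] (d : ℕ) (A : Set X) : Prop :=
  ∀ ε > 0, ∀ᶠ r : ℝ in 𝓝[>] 0, ∃ (n : ℕ) (q : X → ℕ), (∀ x ∈ A, q x < n) ∧
    (∀ x ∈ A, ∀ y ∈ A, q x = q y → dist x y ≤ r) ∧ n * r ^ d ≤ ε

namespace HasZeroMinkowskiContent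

variable {X Y : Type*} [PseudoMetricSpace X] [PseudoMetricSpace Y] {d : ℕ}

lemma empty : HasZeroMinkowskiContent d (∅ : Set X) := fun ε hε =>
  Eventually.of_forall fun r => ⟨0, fun _ => 0, by simp [hε.le]⟩

lemma mono {A A' : Set X} (h : A ⊆ A') (hA' : HasZeroMinkowskiContent d A') :
    HasZeroMinkowskiContent d A := fun ε hε => by
  filter_upwards [hA' ε hε] with r ⟨n, q, hn, hq, hr⟩
  exact ⟨n, q, fun x hx => hn x (h hx), fun x hx y hy => hq x (h hx) y (h hy), hr⟩

lemma union {A A' : Set X} (hA : HasZeroMinkowskiContent d A)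
    (hA' : HasZeroMinkowskiContent d A') : HasZeroMinkowskiContent d (A ∪ A') := fun ε hε => by
  classical
  filter_upwards [hA (ε / 2) (by positivity), hA' (ε / 2) (by positivity)]
    with r ⟨n, q, hn, hq, hr⟩ ⟨n', q', hn', hq', hr'⟩
  refine ⟨n + n', fun x => if x ∈ A then q x else n + q' x, ?_, ?_, ?_⟩
  · intro x hx
    beta_reduce
    split_ifs with h
    · exact (hn x h).trans_le (Nat.le_add_right _ _)
    · exact Nat.add_lt_add_left (hn' x (hx.resolve_left h)) n
  · intro x hx y hy hxy
    beta_reduce at hxy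
    split_ifs at hxy with h h' h'
    · exact hq x h y h' hxy
    · have := hn x h
      omega
    · have := hn y h'
      omega
    · exact hq' x (hx.resolve_left h) y (hy.resolve_left h') (by omega)
  · push_cast
    linarith

lemma iUnion_fin {l : ℕ} {B : Fin l → Set X} (h : ∀ i, HasZeroMinkowskiContent d (B i)) :
    HasZeroMinkowskiContent d (⋃ i, B i) := by
  have key : ∀ s : Finset (Fin l), HasZeroMinkowskiContent d (⋃ i ∈ s, B i) := by
    intro s
    induction s using Finset.induction_on with
    | empty => simpa using empty
    | insert a s _ ih =>
      rw [Finset.set_biUnion_insert]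
      exact (h a).union ih
  simpa using key Finset.univ

lemma of_le_mul_dist {K : Set X} {S : Set Y} (hK : HasZeroMinkowskiContent d K) {g : Y → X}
    (hg : MapsTo g S K) {L : ℝ} (hL : 0 < L)
    (hgL : ∀ x ∈ S, ∀ y ∈ S, dist x y ≤ L * dist (g x) (g y)) :
    HasZeroMinkowskiContent d S := fun ε hε => by
  have hlim : Tendsto (fun r : ℝ => r / L) (𝓝[>] 0) (𝓝[>] 0) := by
    refine tendsto_nhdsWithin_iff.2 ⟨?_, ?_⟩
    · have : Tendsto (fun r : ℝ => r / L) (𝓝 0) (𝓝 (0 / L)) := tendsto_id.div_const L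
      rw [zero_div] at this
      exact this.mono_left nhdsWithin_le_nhds
    · filter_upwards [self_mem_nhdsWithin] with r hr
      exact div_pos hr hL
  filter_upwards [hlim.eventually (hK (ε / L ^ d) (by positivity))] with r ⟨n, q, hn, hq, hr⟩
  refine ⟨n, q ∘ g, fun x hx => hn _ (hg hx), fun x hx y hy hxy => ?_, ?_⟩
  · have h1 := hq _ (hg hx) _ (hg hy) hxy
    rw [le_div_iff₀ hL] at h1
    linarith [hgL x hx y hy]
  · rw [div_pow, ← mul_div_assoc] at hr
    exact (div_le_div_iff_of_pos_right (by positivity)).1 hr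

end HasZeroMinkowskiContent

/-- A compact null set of a finite-dimensional space has zero Minkowski content. -/
lemma IsCompact.hasZeroMinkowskiContent {E : Type*} [NormedAddCommGroup E] [NormedSpace ℝ E]
    [FiniteDimensional ℝ E] [MeasurableSpace E] [BorelSpace E] (μ : Measure E)
    [μ.IsAddHaarMeasure] {K : Set E} (hK : IsCompact K) (hμ : μ K = 0) :
    HasZeroMinkowskiContent (Module.finrank ℝ E) K := fun ε hε => by
  have : ProperSpace E := FiniteDimensional.proper ℝ E
  set D := Module.finrank ℝ E
  set b : ℝ := μ.real (ball 0 1)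
  have hb : 0 < b := ENNReal.toReal_pos (measure_ball_pos μ _ one_pos).ne' measure_ball_lt_top.ne
  have h0 : Tendsto (fun r : ℝ => μ.real (cthickening (r / 4) K)) (𝓝 0) (𝓝 0) := by
    have h1 := tendsto_measure_cthickening_of_isCompact (μ := μ) hK
    rw [hμ] at h1
    have h2 : Tendsto (fun r : ℝ => r / 4) (𝓝 0) (𝓝 0) := by
      simpa using (tendsto_id (x := 𝓝 (0 : ℝ))).div_const 4
    exact (ENNReal.tendsto_toReal ENNReal.zero_ne_top).comp (h1.comp h2)
  have h0' := (h0.mono_left (nhdsWithin_le_nhds (s := Ioi 0))).eventually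
    (gt_mem_nhds (show 0 < ε * b / 4 ^ D by positivity))
  filter_upwards [h0', self_mem_nhdsWithin] with r hr hr0
  replace hr0 : 0 < r := hr0
  lift r to ℝ≥0 using hr0.le
  set ρ := r / 2 with hρ
  have hρr : (ρ : ℝ) = r / 2 := by simp [hρ]
  have hρ0 : ρ ≠ 0 := by
    have : 0 < r := hr0
    positivity
  have hfin : packingNumber ρ K ≠ ⊤ := by
    have hρ2 : ρ / 2 ≠ 0 := by positivity
    obtain ⟨C, -, hCf, hC⟩ := exists_finite_isCover_of_isCompact hρ2 hK
    have h1 := packingNumber_two_mul_le_externalCoveringNumber (ρ / 2) K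
    rw [mul_div_cancel₀ _ (two_ne_zero)] at h1
    exact ne_top_of_le_ne_top (Set.encard_ne_top_iff.2 hCf)
      (h1.trans hC.externalCoveringNumber_le_encard)
  have hTfin : (maximalSeparatedSet ρ K).Finite := by
    rw [← Set.encard_ne_top_iff, encard_maximalSeparatedSet hfin]
    exact hfin
  have hcov := (isCover_maximalSeparatedSet hfin).subset_iUnion_closedBall
  have hsep := isSeparated_maximalSeparatedSet (ε := ρ) (A := K)
  have hsub := maximalSeparatedSet_subset (ε := ρ) (A := K)
  obtain ⟨T, hT⟩ := hTfin.exists_finset_coe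
  rw [← hT] at hcov hsep hsub
  have hcov' : ∀ x ∈ K, ∃ t : T, x ∈ closedBall (t : E) ρ := fun x hx => by
    obtain ⟨t, ht, hxt⟩ := mem_iUnion₂.1 (hcov hx)
    exact ⟨⟨t, ht⟩, hxt⟩
  choose p hp using fun x : K => hcov' x x.2
  classical
  refine ⟨T.card, fun x => if h : x ∈ K then T.equivFin (p ⟨x, h⟩) else 0, ?_, ?_, ?_⟩
  · intro x hx
    simp only [hx, dif_pos]
    exact (T.equivFin _).2
  · intro x hx y hy hxy
    simp only [hx, hy, dif_pos] at hxy
    have h1 : p ⟨x, hx⟩ = p ⟨y, hy⟩ := T.equivFin.injective (Fin.ext hxy)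
    have h2 := mem_closedBall.1 (hp ⟨x, hx⟩)
    have h3 := mem_closedBall.1 (hp ⟨y, hy⟩)
    rw [← h1] at h3
    have h4 := dist_triangle_right x y (p ⟨x, hx⟩ : E)
    rw [hρr] at h2 h3
    simp only at h2 h3
    linarith
  · have hdisj : (T : Set E).PairwiseDisjoint fun t => ball t (r / 4 : ℝ) := by
      intro s hs t ht hst
      refine ball_disjoint_ball ?_
      have h1 : (ρ : ℝ≥0∞) < edist s t := hsep hs ht hst
      rw [edist_nndist, ENNReal.coe_lt_coe, ← NNReal.coe_lt_coe, coe_nndist, hρr] at h1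
      linarith
    have hsubT : (⋃ t ∈ T, ball t (r / 4 : ℝ)) ⊆ cthickening (r / 4 : ℝ) K :=
      iUnion₂_subset fun t ht => ball_subset_closedBall.trans
        (closedBall_subset_cthickening (hsub ht) _)
    have h1 : μ.real (⋃ t ∈ T, ball t (r / 4 : ℝ)) ≤ μ.real (cthickening (r / 4 : ℝ) K) :=
      measureReal_mono hsubT (hK.cthickening.measure_lt_top.ne)
    rw [measureReal_biUnion_finset hdisj (fun _ _ => measurableSet_ball)
      (fun _ _ => measure_ball_lt_top.ne)] at h1
    have h2 : ∀ t ∈ T, μ.real (ball t (r / 4 : ℝ)) = (r / 4 : ℝ) ^ D * b := fun t _ => by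
      rw [Measure.real, Measure.addHaar_ball_of_pos μ t (by positivity), ENNReal.toReal_mul,
        ENNReal.toReal_ofReal (by positivity)]
      rfl
    rw [Finset.sum_congr rfl h2, Finset.sum_const, nsmul_eq_mul] at h1
    have h3 := h1.trans hr.le
    rw [div_pow, le_div_iff₀ (by positivity)] at h3
    have h4 : T.card * ((r : ℝ) ^ D / 4 ^ D * b) * 4 ^ D = T.card * (r : ℝ) ^ D * b := by
      field_simp
    rw [h4] at h3
    exact le_of_mul_le_mul_right h3 hb

/-- A `C¹` map with injective derivative at a point is bi-Lipschitz near that point. -/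
lemma HasStrictFDerivAt.exists_biLipschitz_nhds {E F : Type*} [NormedAddCommGroup E]
    [NormedSpace ℝ E] [FiniteDimensional ℝ E] [NormedAddCommGroup F] [NormedSpace ℝ F]
    {f : E → F} {f' : E →L[ℝ] F} {x : E} (hf : HasStrictFDerivAt f f' x)
    (hf' : Function.Injective f') :
    ∃ s ∈ 𝓝 x, ∃ L : ℝ≥0, 0 < L ∧ LipschitzOnWith L f s ∧
      ∀ u ∈ s, ∀ v ∈ s, dist u v ≤ L * dist (f u) (f v) := by
  obtain ⟨C, hC0, hC⟩ := f'.toLinearMap.exists_antilipschitzWith (LinearMap.ker_eq_bot.2 hf')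
  set c : ℝ≥0 := (2 * C)⁻¹
  obtain ⟨s, hs, happ⟩ := hf.approximates_deriv_on_nhds (c := c) (Or.inr (by positivity))
  refine ⟨s, hs, max (‖f'‖₊ + c) (2 * C), lt_max_of_lt_right (by positivity),
    (lipschitzOnWith_iff_restrict.2 happ.lipschitz).weaken (le_max_left _ _), fun u hu v hv => ?_⟩
  have h1 := hC.le_mul_dist u v
  have h2 := happ u hu v hv
  have h3 : ‖f' (u - v)‖ ≤ ‖f u - f v‖ + ‖f u - f v - f' (u - v)‖ := by
    have := norm_sub_le (f u - f v) (f u - f v - f' (u - v))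
    rwa [sub_sub_cancel] at this
  have h4 : (2 * C : ℝ) ≤ max (‖f'‖₊ + c : ℝ≥0) (2 * C : ℝ≥0) := by
    exact_mod_cast le_max_right _ _
  have h5 : (c : ℝ) = (2 * (C : ℝ))⁻¹ := by simp [c]
  have hC0' : (0 : ℝ) < C := hC0
  rw [dist_eq_norm, dist_eq_norm, ContinuousLinearMap.coe_coe, ← map_sub] at h1
  rw [dist_eq_norm, dist_eq_norm]
  have h6 : (C : ℝ) * (c * ‖u - v‖) = ‖u - v‖ / 2 := by
    rw [h5]
    field_simp
  have h7 := mul_le_mul_of_nonneg_left (h3.trans (add_le_add_right h2 _)) hC0'.le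
  have h8 := mul_le_mul_of_nonneg_right h4 (norm_nonneg (f u - f v))
  linarith

/-- A compact `d`-null subset of a `d`-dimensional embedded `C¹`-manifold has zero Minkowski
content. -/
lemma IsC1EmbeddedManifold.hasZeroMinkowskiContent {d m : ℕ} {W B : Set (Euc m)}
    (hW : IsC1EmbeddedManifold d m W) (hBW : B ⊆ W) (hB : IsCompact B)
    (hnull : μH[(d : ℝ)] B = 0) : HasZeroMinkowskiContent d B := by
  refine hB.induction_on .empty (fun _ _ => .mono) (fun _ _ => .union) fun y hy => ?_
  obtain ⟨V, U, f, g, hyV, ⟨O, hO, rfl⟩, hU, hbij, hf, hg, hgf, hrank⟩ := hW y (hBW hy)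
  obtain ⟨u₀, hu₀, rfl⟩ := hbij.surjOn hyV
  have hstrict : HasStrictFDerivAt f (fderiv ℝ f u₀) u₀ :=
    (hf.contDiffAt (hU.mem_nhds hu₀)).hasStrictFDerivAt one_ne_zero
  have hinj : Function.Injective (fderiv ℝ f u₀) := by
    have h1 : Module.finrank ℝ (fderiv ℝ f u₀).toLinearMap.range = d := by
      have := hrank u₀ hu₀
      rw [Module.finrank, ← LinearMap.rank, this, Cardinal.toNat_natCast]
    have h2 := (fderiv ℝ f u₀).toLinearMap.finrank_range_add_finrank_ker
    rw [h1, finrank_euclideanSpace_fin, Nat.add_eq_left, Submodule.finrank_eq_zero] at h2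
    exact LinearMap.ker_eq_bot.1 h2
  obtain ⟨s, hs, L, hL, hLip, hanti⟩ := hstrict.exists_biLipschitz_nhds hinj
  obtain ⟨δ, hδ, hδs⟩ := nhds_basis_closedBall.mem_iff.1 (inter_mem hs (hU.mem_nhds hu₀))
  set K : Set (Euc d) := closedBall u₀ δ ∩ f ⁻¹' B
  have hKs : K ⊆ s := fun u hu => (hδs hu.1).1
  have hKU : K ⊆ U := fun u hu => (hδs hu.1).2
  have hKc : IsCompact K := by
    have hcont : ContinuousOn f (closedBall u₀ δ) :=
      hf.continuousOn.mono fun u hu => (hδs hu).2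
    exact (isCompact_closedBall u₀ δ).of_isClosed_subset
      (hcont.preimage_isClosed_of_isClosed isClosed_closedBall hB.isClosed) inter_subset_left
  have hfK : f '' K ⊆ B := image_subset_iff.2 fun u hu => hu.2
  have hgLip : LipschitzOnWith L g (f '' K) := by
    refine LipschitzOnWith.of_dist_le_mul ?_
    rintro _ ⟨u, hu, rfl⟩ _ ⟨v, hv, rfl⟩
    rw [hgf (hKU hu), hgf (hKU hv)]
    exact hanti u (hKs hu) v (hKs hv)
  have hKnull : μH[(d : ℝ)] K = 0 := by
    have h1 := hgLip.hausdorffMeasure_image_le (d := d) (Nat.cast_nonneg d)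
    rw [(hgf.mono hKU).image_image, measure_mono_null hfK hnull, mul_zero] at h1
    exact nonpos_iff_eq_zero.1 h1
  have hK : HasZeroMinkowskiContent d K := by
    have := isAddHaarMeasure_hausdorffMeasure (E := Euc d)
    have h := hKc.hasZeroMinkowskiContent μH[Module.finrank ℝ (Euc d)] (by simpa using hKnull)
    simpa using h
  have hfg : ∀ z ∈ O ∩ W, g z ∈ U ∧ f (g z) = z := by
    intro z hz
    obtain ⟨u, hu, rfl⟩ := hbij.surjOn hz
    rw [hgf hu]
    exact ⟨hu, rfl⟩
  refine ⟨{z | z ∈ B ∩ O ∧ g z ∈ closedBall u₀ δ}, ?_,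
    hK.of_le_mul_dist (g := g) (L := L) ?_ hL ?_⟩
  · have h1 : ∀ᶠ z in 𝓝[O ∩ W] (f u₀), g z ∈ closedBall u₀ δ := by
      have := hg _ hyV
      rw [ContinuousWithinAt, hgf hu₀] at this
      exact this (closedBall_mem_nhds u₀ hδ)
    have h2 : 𝓝[B] (f u₀) ≤ 𝓝[O ∩ W] (f u₀) :=
      nhdsWithin_le_of_mem (inter_mem (mem_nhdsWithin_of_mem_nhds (hO.mem_nhds hyV.1))
        (mem_of_superset self_mem_nhdsWithin hBW))
    filter_upwards [h2 h1, self_mem_nhdsWithin, mem_nhdsWithin_of_mem_nhds (hO.mem_nhds hyV.1)]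
      with z hz hzB hzO
    exact ⟨⟨hzB, hzO⟩, hz⟩
  · intro z hz
    refine ⟨hz.2, ?_⟩
    rw [mem_preimage, (hfg z ⟨hz.1.2, hBW hz.1.1⟩).2]
    exact hz.1.1
  · intro z hz w hw
    have hz' := (hfg z ⟨hz.1.2, hBW hz.1.1⟩).2
    have hw' := (hfg w ⟨hw.1.2, hBW hw.1.1⟩).2
    have := hLip.dist_le_mul _ (hδs hz.2).1 _ (hδs hw.2).1
    rwa [hz', hw'] at this

/-- Among `N` objects labelled by at most `N / 2` labels, many pairs share their label. -/
lemma sq_le_four_mul_card_mul_sum_eq {n N : ℕ} {q : ℕ → ℕ} (hq : ∀ i < N, q i < n)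
    (hn : 2 * n ≤ N) :
    (N : ℝ) ^ 2 ≤ 4 * n * ∑ i ∈ Finset.range N, ∑ j ∈ Finset.range i,
      if q i = q j then (1 : ℝ) else 0 := by
  set P := ∑ i ∈ Finset.range N, ∑ j ∈ Finset.range i, if q i = q j then (1 : ℝ) else 0
  have hsym : ∀ M : ℕ, ∑ i ∈ Finset.range M, ∑ j ∈ Finset.range M,
      (if q i = q j then (1 : ℝ) else 0) =
      2 * (∑ i ∈ Finset.range M, ∑ j ∈ Finset.range i, if q i = q j then (1 : ℝ) else 0) + M := by
    intro M
    induction M with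
    | zero => simp
    | succ M ih =>
      have hcomm : ∑ i ∈ Finset.range M, (if q i = q M then (1 : ℝ) else 0) =
          ∑ i ∈ Finset.range M, (if q M = q i then (1 : ℝ) else 0) :=
        Finset.sum_congr rfl fun i _ => by simp only [eq_comm]
      simp_rw [Finset.sum_range_succ, Finset.sum_add_distrib]
      rw [ih, hcomm]
      push_cast
      simp
      ring
  have hfib : ∑ t ∈ Finset.range n, (∑ i ∈ Finset.range N, if q i = t then (1 : ℝ) else 0) = N := by
    rw [Finset.sum_comm, Finset.sum_congr rfl (g := fun _ => (1 : ℝ))]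
    · simp
    · intro i hi
      rw [Finset.sum_ite_eq, if_pos (Finset.mem_range.2 (hq i (Finset.mem_range.1 hi)))]
  have hsq : ∑ t ∈ Finset.range n, (∑ i ∈ Finset.range N, if q i = t then (1 : ℝ) else 0) ^ 2 =
      2 * P + N := by
    rw [← hsym N]
    simp_rw [sq, Finset.sum_mul_sum]
    rw [Finset.sum_comm]
    refine Finset.sum_congr rfl fun i hi => ?_
    rw [Finset.sum_comm]
    refine Finset.sum_congr rfl fun j _ => ?_
    simp_rw [ite_mul, one_mul, zero_mul]
    rw [Finset.sum_ite_eq, if_pos (Finset.mem_range.2 (hq i (Finset.mem_range.1 hi)))]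
    simp only [eq_comm]
  have hCS := sq_sum_le_card_mul_sum_sq (s := Finset.range n)
    (f := fun t => ∑ i ∈ Finset.range N, if q i = t then (1 : ℝ) else 0)
  rw [hfib, hsq, Finset.card_range] at hCS
  have hn' : (2 * n : ℝ) ≤ N := by exact_mod_cast hn
  nlinarith [mul_le_mul_of_nonneg_right hn' (Nat.cast_nonneg (α := ℝ) N)]

/-- The Riesz kernel dominates a sum of truncated kernels over dyadic scales. -/
lemma sum_dyadic_le_rpow_neg {d : ℕ} (hd : 0 < d) {e : ℝ} (he : 0 < e) (k : ℕ) :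
    ∑ i ∈ Finset.range k, (if e ≤ (1 / 2 : ℝ) ^ i then (2 : ℝ) ^ (i * d) else 0) ≤
      2 * (e ^ d)⁻¹ := by
  induction k with
  | zero => simp; positivity
  | succ k ih =>
    by_cases h : e ≤ (1 / 2 : ℝ) ^ k
    · have h2 : (2 : ℝ) ≤ 2 ^ d := by
        simpa using pow_le_pow_right₀ (one_le_two (α := ℝ)) hd
      have hgeom : ∀ n : ℕ, ∑ i ∈ Finset.range (n + 1), (2 : ℝ) ^ (i * d) ≤ 2 * 2 ^ (n * d) := by
        intro n
        induction n with
        | zero => simp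
        | succ n ihn =>
          rw [Finset.sum_range_succ, Nat.succ_mul, pow_add]
          nlinarith [pow_pos (two_pos (α := ℝ)) (n * d)]
      calc _ ≤ ∑ i ∈ Finset.range (k + 1), (2 : ℝ) ^ (i * d) := by
            refine Finset.sum_le_sum fun i _ => ?_
            split_ifs
            · exact le_rfl
            · positivity
        _ ≤ 2 * 2 ^ (k * d) := hgeom k
        _ ≤ 2 * (e ^ d)⁻¹ := by
            have h3 := pow_le_pow_left₀ he.le h d
            rw [← pow_mul, one_div, inv_pow] at h3
            gcongr
            rw [le_inv_comm₀ (by positivity) (by positivity)]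
            exact h3
    · rw [Finset.sum_range_succ, if_neg h, add_zero]
      exact ih

lemma ofReal_sum_dyadic_le_edist_rpow_neg {X : Type*} [PseudoMetricSpace X] {d : ℕ} (hd : 0 < d)
    (x y : X) (k₀ k : ℕ) :
    ENNReal.ofReal (1 / 2 * ∑ i ∈ Finset.Ico k₀ k,
      (if dist x y ≤ (1 / 2 : ℝ) ^ i then (2 : ℝ) ^ (i * d) else 0)) ≤
      edist x y ^ (-(d : ℝ)) := by
  rcases (dist_nonneg (x := x) (y := y)).eq_or_lt with h | h
  · rw [edist_dist, ← h, ENNReal.ofReal_zero,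
      ENNReal.zero_rpow_of_neg (neg_lt_zero.2 (by exact_mod_cast hd))]
    exact le_top
  · rw [edist_dist, ENNReal.ofReal_rpow_of_pos h, Real.rpow_neg h.le, Real.rpow_natCast]
    refine ENNReal.ofReal_le_ofReal ?_
    have h1 := sum_dyadic_le_rpow_neg hd h k
    have h2 : ∑ i ∈ Finset.Ico k₀ k,
        (if dist x y ≤ (1 / 2 : ℝ) ^ i then (2 : ℝ) ^ (i * d) else 0) ≤
        ∑ i ∈ Finset.range k, (if dist x y ≤ (1 / 2 : ℝ) ^ i then (2 : ℝ) ^ (i * d) else 0) := by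
      refine Finset.sum_le_sum_of_subset_of_nonneg (fun i hi => ?_) fun i _ _ => ?_
      · exact Finset.mem_range.2 (Finset.mem_Ico.1 hi).2
      · split_ifs <;> positivity
    linarith

/-- Energy of `N` points in a set of zero Minkowski content grows faster than `N ^ 2 log N`. -/
lemma HasZeroMinkowskiContent.eventually_le_energy {X : Type*} [PseudoMetricSpace X] {d : ℕ}
    (hd : 0 < d) {A : Set X} (hA : HasZeroMinkowskiContent d A) {C : ℝ} (hC : 0 < C) :
    ∀ᶠ N : ℕ in atTop, ∀ ω : ℕ → X, (∀ i < N, ω i ∈ A) →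
      ENNReal.ofReal (C * N ^ 2 * Real.log N) ≤
        ∑ i ∈ Finset.range N, ∑ j ∈ Finset.range i, edist (ω i) (ω j) ^ (-(d : ℝ)) := by
  set ε : ℝ := min (1 / 2) (1 / (16 * d * C))
  have hd' : (0 : ℝ) < d := by exact_mod_cast hd
  have hε : 0 < ε := by positivity
  have hε1 : ε ≤ 1 / 2 := min_le_left _ _
  have hε2 : ε * (16 * d * C) ≤ 1 := by
    have : ε ≤ 1 / (16 * d * C) := min_le_right _ _
    rwa [le_div_iff₀ (by positivity)] at this
  have hscale : Tendsto (fun k : ℕ => (1 / 2 : ℝ) ^ k) atTop (𝓝[>] 0) :=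
    tendsto_nhdsWithin_iff.2 ⟨tendsto_pow_atTop_nhds_zero_of_lt_one (by norm_num) (by norm_num),
      Eventually.of_forall fun k => by simp⟩
  obtain ⟨k₀, hk₀⟩ := eventually_atTop.1 (hscale.eventually (hA ε hε))
  have hlog : Tendsto (fun N : ℕ => Real.log N) atTop atTop :=
    Real.tendsto_log_atTop.comp tendsto_natCast_atTop_atTop
  filter_upwards [hlog.eventually_ge_atTop (2 * d * (k₀ + 1)), eventually_ge_atTop 1]
    with N hN hN1 ω hω
  set K := Nat.log (2 ^ d) N
  have hpair : ∀ k ∈ Finset.Ico k₀ K, (N : ℝ) ^ 2 / (4 * ε) ≤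
      ∑ i ∈ Finset.range N, ∑ j ∈ Finset.range i,
        (if dist (ω i) (ω j) ≤ (1 / 2 : ℝ) ^ k then (2 : ℝ) ^ (k * d) else 0) := by
    intro k hk
    rw [Finset.mem_Ico] at hk
    obtain ⟨n, q, hn, hq, hnε⟩ := hk₀ k hk.1
    rw [← pow_mul, one_div, inv_pow, ← div_eq_mul_inv, div_le_iff₀ (by positivity)] at hnε
    have hkN : (2 : ℝ) ^ (k * d) ≤ N := by
      have h1 : (2 ^ d) ^ k ≤ (2 ^ d) ^ K := Nat.pow_le_pow_right (by positivity) hk.2.le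
      have h2 := h1.trans (Nat.pow_log_le_self (2 ^ d) (by omega))
      rw [← pow_mul, mul_comm] at h2
      exact_mod_cast h2
    have h2n : 2 * n ≤ N := by
      have : (2 * n : ℝ) ≤ N := by nlinarith [pow_pos (two_pos (α := ℝ)) (k * d)]
      exact_mod_cast this
    have h1 := sq_le_four_mul_card_mul_sum_eq (q := q ∘ ω) (fun i hi => hn _ (hω i hi)) h2n
    set P := ∑ i ∈ Finset.range N, ∑ j ∈ Finset.range i,
      if (q ∘ ω) i = (q ∘ ω) j then (1 : ℝ) else 0 with hP
    have hP0 : 0 ≤ P := Finset.sum_nonneg fun i _ => Finset.sum_nonneg fun j _ => by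
      split_ifs <;> norm_num
    have h2 : (2 : ℝ) ^ (k * d) * P ≤ ∑ i ∈ Finset.range N, ∑ j ∈ Finset.range i,
        (if dist (ω i) (ω j) ≤ (1 / 2 : ℝ) ^ k then (2 : ℝ) ^ (k * d) else 0) := by
      simp_rw [hP, Finset.mul_sum]
      refine Finset.sum_le_sum fun i hi => Finset.sum_le_sum fun j hj => ?_
      rw [Finset.mem_range] at hi hj
      by_cases h : (q ∘ ω) i = (q ∘ ω) j
      · rw [if_pos h, if_pos (hq _ (hω i hi) _ (hω j (hj.trans hi)) h), mul_one]
      · rw [if_neg h, mul_zero]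
        split_ifs <;> positivity
    refine le_trans ?_ h2
    rw [div_le_iff₀ (by positivity)]
    nlinarith [mul_le_mul_of_nonneg_right hnε hP0]
  have hK : Real.log N ≤ (K + 1) * d := by
    have h1 : N < (2 ^ d) ^ (K + 1) := Nat.lt_pow_succ_log_self (Nat.one_lt_two_pow hd.ne') N
    have h2 : (N : ℝ) ≤ 2 ^ (d * (K + 1)) := by
      rw [← pow_mul] at h1
      exact_mod_cast h1.le
    have h3 := Real.log_le_log (by exact_mod_cast hN1) h2
    rw [Real.log_pow] at h3
    push_cast at h3
    have h4 : Real.log 2 ≤ 1 := by linarith [Real.log_two_lt_d9]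
    nlinarith [mul_le_mul_of_nonneg_left h4 (show 0 ≤ d * ((K : ℝ) + 1) by positivity)]
  have hreal : C * N ^ 2 * Real.log N ≤ ∑ i ∈ Finset.range N, ∑ j ∈ Finset.range i,
      (1 / 2 * ∑ k ∈ Finset.Ico k₀ K,
        (if dist (ω i) (ω j) ≤ (1 / 2 : ℝ) ^ k then (2 : ℝ) ^ (k * d) else 0)) := by
    have h1 : ((K : ℝ) - k₀) * ((N : ℝ) ^ 2 / (4 * ε)) ≤ ∑ k ∈ Finset.Ico k₀ K,
        ∑ i ∈ Finset.range N, ∑ j ∈ Finset.range i,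
        (if dist (ω i) (ω j) ≤ (1 / 2 : ℝ) ^ k then (2 : ℝ) ^ (k * d) else 0) := by
      have := Finset.card_nsmul_le_sum _ _ _ hpair
      rw [Nat.card_Ico, nsmul_eq_mul] at this
      refine le_trans (mul_le_mul_of_nonneg_right ?_ (by positivity)) this
      rw [sub_le_iff_le_add]
      exact_mod_cast le_tsub_add
    have h2 : ∑ i ∈ Finset.range N, ∑ j ∈ Finset.range i, (1 / 2 * ∑ k ∈ Finset.Ico k₀ K,
        (if dist (ω i) (ω j) ≤ (1 / 2 : ℝ) ^ k then (2 : ℝ) ^ (k * d) else 0)) =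
        1 / 2 * ∑ k ∈ Finset.Ico k₀ K, ∑ i ∈ Finset.range N, ∑ j ∈ Finset.range i,
        (if dist (ω i) (ω j) ≤ (1 / 2 : ℝ) ^ k then (2 : ℝ) ^ (k * d) else 0) := by
      simp_rw [← Finset.mul_sum]
      rw [Finset.sum_comm]
      simp_rw [Finset.sum_comm (s := Finset.Ico k₀ K)]
    rw [h2]
    have hlog2 : Real.log N / (2 * d) ≤ (K : ℝ) - k₀ := by
      rw [div_le_iff₀ (by positivity)]
      nlinarith
    have h3 : C * N ^ 2 * Real.log N ≤
        1 / 2 * (Real.log N / (2 * d) * ((N : ℝ) ^ 2 / (4 * ε))) := by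
      have h4 : 1 / 2 * (Real.log N / (2 * d) * ((N : ℝ) ^ 2 / (4 * ε))) =
          (N ^ 2 * Real.log N) / (16 * d * ε) := by
        field_simp
        ring
      rw [h4, le_div_iff₀ (by positivity)]
      have h5 : 0 ≤ (N : ℝ) ^ 2 * Real.log N :=
        mul_nonneg (by positivity) (Real.log_natCast_nonneg N)
      nlinarith [mul_le_mul_of_nonneg_right hε2 h5]
    have h6 := mul_le_mul_of_nonneg_right hlog2 (show 0 ≤ (N : ℝ) ^ 2 / (4 * ε) by positivity)
    linarith
  refine (ENNReal.ofReal_le_ofReal hreal).trans ?_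
  have hnonneg : ∀ i j, 0 ≤ 1 / 2 * ∑ k ∈ Finset.Ico k₀ K,
      (if dist (ω i) (ω j) ≤ (1 / 2 : ℝ) ^ k then (2 : ℝ) ^ (k * d) else 0) := fun i j => by
    refine mul_nonneg (by norm_num) (Finset.sum_nonneg fun k _ => ?_)
    split_ifs <;> positivity
  rw [ENNReal.ofReal_sum_of_nonneg fun i _ => Finset.sum_nonneg fun j _ => hnonneg i j]
  refine Finset.sum_le_sum fun i _ => ?_
  rw [ENNReal.ofReal_sum_of_nonneg fun j _ => hnonneg i j]
  exact Finset.sum_le_sum fun j _ => ofReal_sum_dyadic_le_edist_rpow_neg hd _ _ _ _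

/-- Greedy configurations: each point minimizes over `A` the potential of the previous ones. -/
lemma IsCompact.exists_greedy {X : Type*} [PseudoEMetricSpace X] {A : Set X} (hA : IsCompact A)
    (hne : A.Nonempty) (s : ℝ) (N : ℕ) :
    ∃ ω : ℕ → X, ∀ n < N, ω n ∈ A ∧ ∀ y ∈ A,
      ∑ i ∈ Finset.range n, edist (ω n) (ω i) ^ s ≤ ∑ i ∈ Finset.range n, edist y (ω i) ^ s := by
  induction N with
  | zero => exact ⟨fun _ => hne.some, by simp⟩
  | succ N ih =>
    obtain ⟨ω, hω⟩ := ih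
    have hcont : Continuous fun y => ∑ i ∈ Finset.range N, edist y (ω i) ^ s := by
      refine continuous_finsetSum _ fun i _ => ?_
      exact ENNReal.continuous_rpow_const.comp (continuous_id.edist continuous_const)
    obtain ⟨z, hzA, hz⟩ := hA.exists_isMinOn hne hcont.continuousOn
    have hlt : ∀ i < N, Function.update ω N z i = ω i := fun i hi =>
      Function.update_of_ne hi.ne _ _
    have hsum : ∀ n ≤ N, ∀ y, ∑ i ∈ Finset.range n, edist y (Function.update ω N z i) ^ s =
        ∑ i ∈ Finset.range n, edist y (ω i) ^ s := fun n hn y =>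
      Finset.sum_congr rfl fun i hi => by rw [hlt i ((Finset.mem_range.1 hi).trans_le hn)]
    refine ⟨Function.update ω N z, fun n hn => ?_⟩
    simp_rw [hsum n (Nat.le_of_lt_succ hn)]
    rcases (Nat.le_of_lt_succ hn).eq_or_lt with rfl | h
    · rw [Function.update_self]
      exact ⟨hzA, fun y hy => hz hy⟩
    · rw [hlt n h]
      exact hω n h

/-- `N` times the polarization constant dominates the energy of some `N`-point configuration. -/
lemma exists_energy_le_mul_polarizationConst {m : ℕ} {A : Set (Euc m)} (hA : IsCompact A)
    (hne : A.Nonempty) (s : ℝ) (N : ℕ) :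
    ∃ ω : ℕ → Euc m, (∀ i < N, ω i ∈ A) ∧
      ∑ i ∈ Finset.range N, ∑ j ∈ Finset.range i, edist (ω i) (ω j) ^ (-s) ≤
        N * polarizationConst m A s N := by
  obtain ⟨ω, hω⟩ := hA.exists_greedy hne (-s) N
  refine ⟨ω, fun i hi => (hω i hi).1, ?_⟩
  calc _ ≤ ∑ i ∈ Finset.range N, polarizationConst m A s N := by
        refine Finset.sum_le_sum fun n hn => ?_
        rw [Finset.mem_range] at hn
        refine le_iSup₂_of_le (fun i : Fin N => ω i) (fun i => (hω i i.2).1) ?_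
        refine le_iInf₂ fun y hy => ((hω n hn).2 y hy).trans ?_
        rw [Fin.sum_univ_eq_sum_range fun i => edist y (ω i) ^ (-s)]
        exact Finset.sum_le_sum_of_subset (Finset.range_mono hn.le)
    _ = _ := by simp

/-- for `A = A_1 ∪ ⋯ ∪ A_l` infinite, each `A_i` compact and contained
in a `d`-dimensional `C¹`-manifold in `ℝ^m`, `H_d(A_i ∩ A_j) = 0` for `i < j`, and
`H_d(A) = 0`, one has `M^d_N(A) / (N ln N) → ∞` as `N → ∞`. -/
theorem statement1 (d m l : ℕ) (hd : 0 < d) (hdm : d ≤ m)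
    (B : Fin l → Set (Euc m)) (A : Set (Euc m)) (hAeq : A = ⋃ i, B i)
    (hcomp : ∀ i, IsCompact (B i))
    (hmani : ∀ i, ∃ W : Set (Euc m), IsC1EmbeddedManifold d m W ∧ B i ⊆ W)
    (hinter : ∀ i j : Fin l, i < j → μH[(d:ℝ)] (B i ∩ B j) = 0)
    (hinf : A.Infinite) (hzero : μH[(d:ℝ)] A = 0) :
    Tendsto (fun N : ℕ =>
        polarizationConst m A (d : ℝ) N / ENNReal.ofReal ((N : ℝ) * Real.log N))
      atTop (𝓝 ⊤) := by
  have hnull : ∀ i, μH[(d : ℝ)] (B i) = 0 := fun i =>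
    measure_mono_null (hAeq ▸ subset_iUnion B i) hzero
  have hA : HasZeroMinkowskiContent d A := by
    rw [hAeq]
    refine .iUnion_fin fun i => ?_
    obtain ⟨W, hW, hBW⟩ := hmani i
    exact hW.hasZeroMinkowskiContent hBW (hcomp i) (hnull i)
  have hAc : IsCompact A := hAeq ▸ isCompact_iUnion hcomp
  rw [ENNReal.tendsto_nhds_top_iff_nnreal]
  intro x
  filter_upwards [hA.eventually_le_energy hd (show (0 : ℝ) < x + 1 by positivity),
    eventually_ge_atTop 2] with N hN hN2
  obtain ⟨ω, hωA, hω⟩ := exists_energy_le_mul_polarizationConst hAc hinf.nonempty d N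
  have h1 := (hN ω hωA).trans hω
  have hN0 : (0 : ℝ) < N := by positivity
  have hlog : 0 < Real.log N := Real.log_pos (by exact_mod_cast hN2)
  have h2 : ((x + 1 : ℝ≥0) : ℝ≥0∞) * ENNReal.ofReal (N * Real.log N) ≤
      polarizationConst m A d N := by
    have h3 : ENNReal.ofReal ((x + 1) * N ^ 2 * Real.log N) =
        N * (((x + 1 : ℝ≥0) : ℝ≥0∞) * ENNReal.ofReal (N * Real.log N)) := by
      rw [← ENNReal.ofReal_coe_nnreal, ← ENNReal.ofReal_natCast,
        ← ENNReal.ofReal_mul (by positivity), ← ENNReal.ofReal_mul (by positivity)]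
      push_cast
      ring_nf
    rw [h3] at h1
    exact (ENNReal.mul_le_mul_iff_right (by positivity) (ENNReal.natCast_ne_top N)).1 h1
  refine lt_of_lt_of_le ?_ ((ENNReal.le_div_iff_mul_le (Or.inl ?_) (Or.inl ?_)).2 h2)
  · exact_mod_cast lt_add_one x
  · exact (ENNReal.ofReal_pos.2 (by positivity)).ne'
  · exact ENNReal.ofReal_ne_top

end
end

section
/- Let d ≤ m be positive integers and let A = A_1 ∪ … ∪ A_l be an infinite subset of ℝ^m, where each A_i is a compact set contained in some d-dimensional C^1-manifold embedded in ℝ^m and H_d(A_i ∩ A_j) = 0 for all 1 ≤ i < j ≤ l. Assume H_d(A) > 0. If ω_N = {x_{1,N},…,x_{N,N}}, N ∈ ℕ, is a sequence of N-point configurations on A that is asymptotically optimal for the N-point d-polarization problem on A, then the normalized counting measures (1/N) Σ_{i=1}^N δ_{x_{i,N}} converge in the weak* topology of measures to H_d(·)|_A / H_d(A) as N → ∞. -/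
open MeasureTheory Filter Set Metric
open scoped ENNReal NNReal Topology

noncomputable section

/-- `φ` maps `P` onto its image in `ℝ^d` so that it and its inverse are `L`-Lipschitz. -/
def IsFlatOn {d m : ℕ} (L : ℝ≥0) (P : Set (Euc m)) (φ : Euc m → Euc d) : Prop :=
  LipschitzOnWith L φ P ∧ ∃ ψ : Euc d → Euc m, LipschitzOnWith L ψ (φ '' P) ∧ LeftInvOn ψ φ P

namespace IsFlatOn

variable {d m : ℕ} {L : ℝ≥0} {P Q : Set (Euc m)} {φ : Euc m → Euc d}

lemma of_dist (h : ∀ x ∈ P, ∀ y ∈ P, dist (φ x) (φ y) ≤ L * dist x y ∧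
    dist x y ≤ L * dist (φ x) (φ y)) : IsFlatOn L P φ := by
  have hinj : InjOn φ P := fun x hx y hy hxy => by
    have := (h x hx y hy).2
    rw [hxy, dist_self, mul_zero] at this
    exact dist_le_zero.1 this
  refine ⟨LipschitzOnWith.of_dist_le_mul fun x hx y hy => (h x hx y hy).1,
    Function.invFunOn φ P, LipschitzOnWith.of_dist_le_mul ?_, hinj.leftInvOn_invFunOn⟩
  rintro _ ⟨x, hx, rfl⟩ _ ⟨y, hy, rfl⟩
  rw [hinj.leftInvOn_invFunOn hx, hinj.leftInvOn_invFunOn hy]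
  exact (h x hx y hy).2

lemma mono (h : IsFlatOn L P φ) (hQ : Q ⊆ P) : IsFlatOn L Q φ := by
  obtain ⟨h1, ψ, h2, h3⟩ := h
  exact ⟨h1.mono hQ, ψ, h2.mono (image_mono hQ), h3.mono hQ⟩

lemma dist_le (h : IsFlatOn L P φ) {x y : Euc m} (hx : x ∈ P) (hy : y ∈ P) :
    dist x y ≤ L * dist (φ x) (φ y) := by
  obtain ⟨h1, ψ, h2, h3⟩ := h
  simpa [h3 hx, h3 hy] using h2.dist_le_mul _ (mem_image_of_mem φ hx) _ (mem_image_of_mem φ hy)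

lemma hausdorffMeasure_image_le (h : IsFlatOn L P φ) :
    μH[(d:ℝ)] (φ '' P) ≤ (L : ℝ≥0∞) ^ d * μH[(d:ℝ)] P := by
  simpa using h.1.hausdorffMeasure_image_le (d := (d:ℝ)) (by positivity)

lemma hausdorffMeasure_le (h : IsFlatOn L P φ) :
    μH[(d:ℝ)] P ≤ (L : ℝ≥0∞) ^ d * μH[(d:ℝ)] (φ '' P) := by
  obtain ⟨h1, ψ, h2, h3⟩ := h
  have := h2.hausdorffMeasure_image_le (d := (d:ℝ)) (by positivity)
  rw [h3.image_image] at this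
  simpa using this

end IsFlatOn

/-- Near each of its points an embedded `C¹`-manifold is nearly isometric to a piece of `ℝ^d`. -/
lemma IsC1EmbeddedManifold.exists_isFlatOn {d m : ℕ} {W : Set (Euc m)}
    (hW : IsC1EmbeddedManifold d m W) {L : ℝ≥0} (hL : 1 < L) {y : Euc m} (hy : y ∈ W) :
    ∃ O : Set (Euc m), IsOpen O ∧ y ∈ O ∧ ∃ φ : Euc m → Euc d, IsFlatOn L (O ∩ W) φ := by
  obtain ⟨V, U, f, g, hyV, ⟨O, hO, rfl⟩, hU, hbij, hf, hg, hinv, hrank⟩ := hW y hy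
  have hgU : ∀ x ∈ O ∩ W, g x ∈ U ∧ f (g x) = x := fun x hx => by
    obtain ⟨u, hu, rfl⟩ := hbij.surjOn hx
    rw [hinv hu]
    exact ⟨hu, rfl⟩
  set x₀ := g y with hx₀
  have hx₀U : x₀ ∈ U := (hgU y hyV).1
  have hstrict : HasStrictFDerivAt f (fderiv ℝ f x₀) x₀ :=
    (hf.contDiffAt (hU.mem_nhds hx₀U)).hasStrictFDerivAt one_ne_zero
  set f' := fderiv ℝ f x₀ with hf'
  have hfr : Module.finrank ℝ (LinearMap.range f'.toLinearMap) = d := by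
    have := hrank x₀ hx₀U
    rw [LinearMap.rank, ← Module.finrank_eq_rank] at this
    exact_mod_cast this
  have hker : LinearMap.ker f'.toLinearMap = ⊥ := by
    have h1 := LinearMap.finrank_range_add_finrank_ker f'.toLinearMap
    rw [hfr, finrank_euclideanSpace_fin] at h1
    exact Submodule.finrank_eq_zero.1 (by omega)
  let e : LinearMap.range f'.toLinearMap ≃ₗᵢ[ℝ] Euc d :=
    ((stdOrthonormalBasis ℝ (LinearMap.range f'.toLinearMap)).reindex (finCongr hfr)).repr
  let T : Euc d →ₗ[ℝ] Euc d := e.toLinearEquiv.toLinearMap ∘ₗ f'.toLinearMap.rangeRestrict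
  have hT : ∀ v, ‖T v‖ = ‖f' v‖ := fun v => by
    change ‖e (f'.toLinearMap.rangeRestrict v)‖ = _
    rw [e.norm_map]
    rfl
  obtain ⟨K, hK, hanti⟩ := LinearMap.exists_antilipschitzWith f'.toLinearMap hker
  have hlow : ∀ v, ‖v‖ ≤ K * ‖T v‖ := fun v => by
    rw [hT]
    simpa [dist_eq_norm] using hanti.le_mul_dist v 0
  have hL1 : (1:ℝ) < L := by exact_mod_cast hL
  have hK' : (0:ℝ) < K := by exact_mod_cast hK
  have hε : 0 < (1 - (L:ℝ)⁻¹) / K := div_pos (sub_pos.2 (inv_lt_one_of_one_lt₀ hL1)) hK'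
  obtain ⟨S, hS, hSf⟩ := hstrict.approximates_deriv_on_nhds (c := ⟨_, hε.le⟩) (Or.inr hε)
  obtain ⟨t, ht, hyt, hts⟩ := mem_nhdsWithin.1 ((hg y hyV) hS)
  refine ⟨t ∩ O, ht.inter hO, ⟨hyt, hyV.1⟩, fun x => T (g x), IsFlatOn.of_dist ?_⟩
  rintro x ⟨⟨hxt, hxO⟩, hxW⟩ z ⟨⟨hzt, hzO⟩, hzW⟩
  have key : ‖x - z - f' (g x - g z)‖ ≤ (1 - (L:ℝ)⁻¹) * ‖T (g x - g z)‖ := by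
    have h1 := hSf (g x) (hts ⟨hxt, hxO, hxW⟩) (g z) (hts ⟨hzt, hzO, hzW⟩)
    rw [(hgU x ⟨hxO, hxW⟩).2, (hgU z ⟨hzO, hzW⟩).2] at h1
    refine h1.trans ?_
    change (1 - (L:ℝ)⁻¹) / K * ‖g x - g z‖ ≤ _
    calc _ ≤ (1 - (L:ℝ)⁻¹) / K * (K * ‖T (g x - g z)‖) := by gcongr; exact hlow _
      _ = _ := by field_simp
  rw [dist_eq_norm, dist_eq_norm, ← map_sub]
  set a := ‖T (g x - g z)‖ with ha
  have h2 : |‖x - z‖ - a| ≤ (1 - (L:ℝ)⁻¹) * a := by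
    rw [ha] at key ⊢
    rw [hT] at key ⊢
    exact (abs_norm_sub_norm_le _ _).trans key
  have ha0 : 0 ≤ a := norm_nonneg _
  have hL0 : (0:ℝ) < L := by linarith
  have hLL : (L:ℝ) * (L:ℝ)⁻¹ = 1 := mul_inv_cancel₀ hL0.ne'
  have hinv0 : 0 < (L:ℝ)⁻¹ := inv_pos.2 hL0
  obtain ⟨h3, h4⟩ := abs_le.1 h2
  have h5 : (L:ℝ)⁻¹ * a ≤ ‖x - z‖ := by linarith
  have h6 : ‖x - z‖ ≤ (2 - (L:ℝ)⁻¹) * a := by linarith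
  have h7 : 2 - (L:ℝ)⁻¹ ≤ L := by nlinarith [sq_nonneg ((L:ℝ) - 1)]
  constructor
  · calc a = L * ((L:ℝ)⁻¹ * a) := by rw [← mul_assoc, hLL, one_mul]
      _ ≤ L * ‖x - z‖ := by gcongr
  · exact h6.trans (by gcongr)

/-- `S` is a finite union of compact nearly flat pieces that overlap in `H_d`-null sets only. -/
def HasFlatPartition {m : ℕ} (d : ℕ) (L : ℝ≥0) (S : Set (Euc m)) : Prop :=
  ∃ F : Finset (Set (Euc m)),
    (∀ P ∈ F, IsCompact P ∧ ∃ φ : Euc m → Euc d, IsFlatOn L P φ) ∧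
    (F : Set (Set (Euc m))).Pairwise (AEDisjoint μH[(d:ℝ)]) ∧ S = ⋃ P ∈ F, P

namespace HasFlatPartition

variable {d m : ℕ} {L : ℝ≥0} {S T : Set (Euc m)}

lemma empty : HasFlatPartition d L (∅ : Set (Euc m)) :=
  ⟨∅, by simp, by simp, by simp⟩

lemma of_isFlatOn (hS : IsCompact S) {φ : Euc m → Euc d} (h : IsFlatOn L S φ) :
    HasFlatPartition d L S :=
  ⟨{S}, by simpa using ⟨hS, φ, h⟩, by simp, by simp⟩

lemma union (hS : HasFlatPartition d L S) (hT : HasFlatPartition d L T)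
    (h : μH[(d:ℝ)] (S ∩ T) = 0) : HasFlatPartition d L (S ∪ T) := by
  classical
  obtain ⟨F, h1, h2, rfl⟩ := hS
  obtain ⟨G, h3, h4, rfl⟩ := hT
  refine ⟨F ∪ G, fun P hP => (Finset.mem_union.1 hP).elim (h1 P) (h3 P), ?_, ?_⟩
  · have key : ∀ P ∈ F, ∀ Q ∈ G, AEDisjoint μH[(d:ℝ)] P Q := fun P hP Q hQ =>
      measure_mono_null (inter_subset_inter (subset_biUnion_of_mem (u := fun P => P) hP)
        (subset_biUnion_of_mem (u := fun P => P) hQ)) h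
    rw [Finset.coe_union]
    intro P hP Q hQ hPQ
    rcases hP with hP | hP <;> rcases hQ with hQ | hQ
    · exact h2 hP hQ hPQ
    · exact key P hP Q hQ
    · exact (key Q hQ P hP).symm
    · exact h4 hP hQ hPQ
  · rw [Finset.set_biUnion_union]

lemma isCompact (hS : HasFlatPartition d L S) : IsCompact S := by
  obtain ⟨F, h1, -, rfl⟩ := hS
  exact F.isCompact_biUnion fun P hP => (h1 P hP).1

end HasFlatPartition

lemma IsFlatOn.hausdorffMeasure_lt_top {d m : ℕ} {L : ℝ≥0} {P : Set (Euc m)}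
    {φ : Euc m → Euc d} (h : IsFlatOn L P φ) (hP : Bornology.IsBounded P) :
    μH[(d:ℝ)] P < ∞ := by
  have : (μH[(d:ℝ)] : Measure (Euc d)).IsAddHaarMeasure := by
    simpa using isAddHaarMeasure_hausdorffMeasure (E := Euc d)
  refine h.hausdorffMeasure_le.trans_lt (ENNReal.mul_lt_top (by finiteness) ?_)
  obtain ⟨R, hR⟩ := isBounded_iff.1 hP
  refine Bornology.IsBounded.measure_lt_top (isBounded_iff.2 ⟨L * R, ?_⟩)
  rintro _ ⟨x, hx, rfl⟩ _ ⟨y, hy, rfl⟩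
  exact (h.1.dist_le_mul _ hx _ hy).trans (by gcongr; exact hR hx hy)

lemma IsC1EmbeddedManifold.hausdorffMeasure_lt_top {d m : ℕ} {W K : Set (Euc m)}
    (hW : IsC1EmbeddedManifold d m W) (hK : IsCompact K) (hKW : K ⊆ W) :
    μH[(d:ℝ)] K < ∞ := by
  refine hK.measure_lt_top_of_nhdsWithin fun y hy => ?_
  obtain ⟨O, hO, hyO, φ, hφ⟩ := hW.exists_isFlatOn (L := 2) (by norm_num) (hKW hy)
  refine ⟨O ∩ K, inter_mem (mem_nhdsWithin_of_mem_nhds (hO.mem_nhds hyO)) self_mem_nhdsWithin, ?_⟩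
  exact (hφ.mono (inter_subset_inter_right O hKW)).hausdorffMeasure_lt_top
    (hK.isBounded.subset inter_subset_right)

lemma IsC1EmbeddedManifold.hasFlatPartition {d m : ℕ} {W K : Set (Euc m)}
    (hW : IsC1EmbeddedManifold d m W) (hK : IsCompact K) (hKW : K ⊆ W) {L : ℝ≥0} (hL : 1 < L) :
    HasFlatPartition d L K := by
  classical
  have hfin : IsFiniteMeasure ((μH[(d:ℝ)] : Measure (Euc m)).restrict K) :=
    ⟨by simpa using hW.hausdorffMeasure_lt_top hK hKW⟩
  have hball : ∀ y ∈ K, ∃ r > 0, μH[(d:ℝ)] (sphere y r ∩ K) = 0 ∧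
      ∃ φ : Euc m → Euc d, IsFlatOn L (K ∩ closedBall y r) φ := fun y hy => by
    obtain ⟨O, hO, hyO, φ, hφ⟩ := hW.exists_isFlatOn hL (hKW hy)
    obtain ⟨ε, hε, hεO⟩ := Metric.isOpen_iff.1 hO y hyO
    obtain ⟨r, ⟨hr0, hrε⟩, hr⟩ := exists_null_frontier_thickening
      ((μH[(d:ℝ)] : Measure (Euc m)).restrict K) {y} hε
    rw [thickening_singleton, frontier_ball _ hr0.ne',
      Measure.restrict_apply isClosed_sphere.measurableSet] at hr
    exact ⟨r, hr0, hr, φ, hφ.mono fun x hx =>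
      ⟨hεO (closedBall_subset_ball hrε hx.2), hKW hx.1⟩⟩
  choose! r hr0 hr φ hφ using hball
  obtain ⟨t, htK, hcov⟩ := hK.elim_nhds_subcover (fun y => ball y (r y))
    fun y hy => ball_mem_nhds y (hr0 y hy)
  suffices h : ∀ s : Finset (Euc m), (∀ y ∈ s, y ∈ K) →
      HasFlatPartition d L (K ∩ ⋃ y ∈ s, closedBall y (r y)) by
    have h1 := h t htK
    rwa [inter_eq_left.2] at h1
    exact hcov.trans (iUnion₂_mono fun y _ => ball_subset_closedBall)
  intro s
  induction s using Finset.induction_on with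
  | empty => intro _; simpa using HasFlatPartition.empty
  | insert y s hys ih =>
    intro hs
    have hyK := hs y (Finset.mem_insert_self _ _)
    have hsK : ∀ z ∈ s, z ∈ K := fun z hz => hs z (Finset.mem_insert_of_mem hz)
    have hopen : IsOpen (⋃ z ∈ s, ball z (r z)) := isOpen_biUnion fun _ _ => isOpen_ball
    have hnew : HasFlatPartition d L ((K ∩ closedBall y (r y)) \ ⋃ z ∈ s, ball z (r z)) :=
      HasFlatPartition.of_isFlatOn ((hK.inter_right isClosed_closedBall).diff hopen)
        ((hφ y hyK).mono sdiff_subset)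
    convert! (ih hsK).union hnew ?_ using 1
    · ext x
      simp only [Finset.mem_insert, iUnion_iUnion_eq_or_left, mem_inter_iff, mem_union, mem_iUnion,
        Set.mem_sdiff, exists_prop, not_exists, not_and]
      constructor
      · rintro ⟨hx, h | h⟩
        · by_cases h' : ∃ z ∈ s, x ∈ ball z (r z)
          · obtain ⟨z, hz, hxz⟩ := h'
            exact Or.inl ⟨hx, z, hz, ball_subset_closedBall hxz⟩
          · push Not at h'
            exact Or.inr ⟨⟨hx, h⟩, h'⟩
        · exact Or.inl ⟨hx, h⟩
      · rintro (⟨hx, h⟩ | ⟨⟨hx, h⟩, -⟩)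
        exacts [⟨hx, Or.inr h⟩, ⟨hx, Or.inl h⟩]
    · refine measure_mono_null (t := ⋃ z ∈ s, (sphere z (r z) ∩ K)) ?_
        ((measure_biUnion_null_iff s.countable_toSet).2 fun z hz => hr z (hsK z hz))
      rintro x ⟨⟨hxK, hx⟩, -, hx'⟩
      simp only [mem_iUnion, exists_prop, not_exists, not_and] at hx hx' ⊢
      obtain ⟨z, hz, hxz⟩ := hx
      exact ⟨z, hz, mem_sphere.2 (le_antisymm hxz (not_lt.1 (hx' z hz))), hxK⟩

lemma hasFlatPartition_iUnion {d m l : ℕ} {L : ℝ≥0} (B : Fin l → Set (Euc m))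
    (h : ∀ i, HasFlatPartition d L (B i))
    (hinter : ∀ i j : Fin l, i < j → μH[(d:ℝ)] (B i ∩ B j) = 0) :
    HasFlatPartition d L (⋃ i, B i) := by
  classical
  suffices h' : ∀ s : Finset (Fin l), HasFlatPartition d L (⋃ i ∈ s, B i) by
    simpa using h' Finset.univ
  intro s
  induction s using Finset.induction_on with
  | empty => simpa using HasFlatPartition.empty
  | insert i s his ih =>
    rw [Finset.set_biUnion_insert]
    refine (h i).union ih ?_
    rw [inter_iUnion₂]
    refine (measure_biUnion_null_iff s.countable_toSet).2 fun j hj => ?_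
    rcases lt_or_gt_of_ne (show i ≠ j by rintro rfl; exact his hj) with hij | hij
    · exact hinter i j hij
    · rw [inter_comm]
      exact hinter j i hij

instance isAddHaarMeasure_hausdorffMeasure_euc (d : ℕ) :
    (μH[(d:ℝ)] : Measure (Euc d)).IsAddHaarMeasure := by
  simpa using isAddHaarMeasure_hausdorffMeasure (E := Euc d)

/-- The pieces of a flat partition can be laid out in `ℝ^d`, far apart from each other. -/
lemma HasFlatPartition.exists_expanding {d m : ℕ} {L : ℝ≥0} {S : Set (Euc m)} (hd : 0 < d)
    (hL : 1 ≤ L) (h : HasFlatPartition d L S) :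
    ∃ Φ : Euc m → Euc d, Bornology.IsBounded (Φ '' S) ∧
      μH[(d:ℝ)] (closure (Φ '' S)) ≤ (L : ℝ≥0∞) ^ d * μH[(d:ℝ)] S ∧
      ∀ x ∈ S, ∀ y ∈ S, dist x y ≤ L * dist (Φ x) (Φ y) := by
  have hScomp := h.isCompact
  obtain ⟨F, h1, h2, rfl⟩ := h
  obtain ⟨D, hD⟩ := isBounded_iff.1 hScomp.isBounded
  have hcomp : ∀ P ∈ F, IsCompact P := fun P hP => (h1 P hP).1
  have h1' : ∀ P ∈ F, ∃ φ : Euc m → Euc d, IsFlatOn L P φ := fun P hP => (h1 P hP).2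
  choose! φ hφ using h1'
  have himg : ∀ P ∈ F, IsCompact (φ P '' P) := fun P hP =>
    (hcomp P hP).image_of_continuousOn (hφ P hP).1.continuousOn
  obtain ⟨R, hR⟩ := isBounded_iff_forall_norm_le.1
    (F.isCompact_biUnion himg).isBounded
  obtain ⟨idx, hidx⟩ := countable_iff_exists_injOn.1 F.countable_toSet
  have hex : ∀ x ∈ ⋃ P ∈ F, P, ∃ P, P ∈ F ∧ x ∈ P := fun x hx => by simpa using hx
  choose! p hpF hxp using hex
  let e : Euc d := EuclideanSpace.single ⟨0, hd⟩ (1:ℝ)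
  have he : ‖e‖ = 1 := by simp [e]
  let v : Set (Euc m) → Euc d := fun P => ((idx P : ℝ) * (2 * R + D)) • e
  let K : Set (Euc m) → Set (Euc d) := fun P => (fun z => z + v P) '' (φ P '' P)
  have hK : ∀ P ∈ F, IsCompact (K P) := fun P hP => (himg P hP).image (by fun_prop)
  have hsub : (fun x => φ (p x) x + v (p x)) '' (⋃ P ∈ F, P) ⊆ ⋃ P ∈ F, K P := by
    rintro _ ⟨x, hx, rfl⟩
    exact mem_biUnion (hpF x hx) ⟨_, ⟨x, hxp x hx, rfl⟩, rfl⟩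
  have hKc : IsCompact (⋃ P ∈ F, K P) := F.isCompact_biUnion hK
  refine ⟨fun x => φ (p x) x + v (p x), hKc.isBounded.subset hsub, ?_, ?_⟩
  · calc μH[(d:ℝ)] (closure ((fun x => φ (p x) x + v (p x)) '' (⋃ P ∈ F, P)))
        ≤ μH[(d:ℝ)] (⋃ P ∈ F, K P) := measure_mono (closure_minimal hsub hKc.isClosed)
      _ ≤ ∑ P ∈ F, μH[(d:ℝ)] (K P) := measure_biUnion_finset_le _ _
      _ ≤ ∑ P ∈ F, (L : ℝ≥0∞) ^ d * μH[(d:ℝ)] P := by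
          refine Finset.sum_le_sum fun P hP => ?_
          have : μH[(d:ℝ)] (K P) = μH[(d:ℝ)] (φ P '' P) := by
            simp only [K, image_add_right, measure_preimage_add_right]
          rw [this]
          exact (hφ P hP).hausdorffMeasure_image_le
      _ = (L : ℝ≥0∞) ^ d * μH[(d:ℝ)] (⋃ P ∈ F, P) := by
          rw [← Finset.mul_sum, measure_biUnion_finset₀ h2
            fun P hP => (hcomp P hP).measurableSet.nullMeasurableSet]
  · intro x hx y hy
    by_cases hxy : p x = p y
    · simp only [hxy, dist_add_right]
      exact (hφ _ (hpF y hy)).dist_le (hxy ▸ hxp x hx) (hxp y hy)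
    · have hn : ∀ z ∈ ⋃ P ∈ F, P, ‖φ (p z) z‖ ≤ R := fun z hz =>
        hR _ (mem_biUnion (hpF z hz) ⟨z, hxp z hz, rfl⟩)
      have hR0 : 0 ≤ R := (norm_nonneg _).trans (hn x hx)
      have hD0 : 0 ≤ D := dist_nonneg.trans (hD hx hx)
      have hv : 2 * R + D ≤ ‖v (p x) - v (p y)‖ := by
        have hne : (idx (p x) : ℤ) - idx (p y) ≠ 0 := fun h0 =>
          hxy (hidx (hpF x hx) (hpF y hy) (by omega))
        have h3 : (1:ℝ) ≤ |(idx (p x) : ℝ) - idx (p y)| := by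
          exact_mod_cast Int.one_le_abs hne
        simp only [v]
        rw [← sub_smul, ← sub_mul, norm_smul, he, mul_one, Real.norm_eq_abs, abs_mul,
          abs_of_nonneg (by positivity : 0 ≤ 2 * R + D)]
        nlinarith
      have hdist : D ≤ dist (φ (p x) x + v (p x)) (φ (p y) y + v (p y)) := by
        rw [dist_eq_norm]
        have h4 : v (p x) - v (p y) = (φ (p x) x + v (p x) - (φ (p y) y + v (p y)))
          - φ (p x) x + φ (p y) y := by abel
        have h5 := norm_add_le ((φ (p x) x + v (p x) - (φ (p y) y + v (p y)))
          - φ (p x) x) (φ (p y) y)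
        have h6 := norm_sub_le (φ (p x) x + v (p x) - (φ (p y) y + v (p y))) (φ (p x) x)
        rw [← h4] at h5
        linarith [hn x hx, hn y hy]
      have hL' : (1:ℝ) ≤ L := by exact_mod_cast hL
      calc dist x y ≤ D := hD hx hy
        _ ≤ _ := hdist
        _ ≤ L * _ := le_mul_of_one_le_left dist_nonneg hL'

/-- Up to a small set, a measurable `K₀` has upper density at most `L ^ (2 * d)` at the points of
`S`, uniformly at small scales. -/
lemma HasFlatPartition.exists_compact_measure_inter_ball_le {d m : ℕ} {L : ℝ≥0}
    {S K₀ : Set (Euc m)} (hL : 1 ≤ L) (h : HasFlatPartition d L S)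
    (hSfin : μH[(d:ℝ)] S < ∞) (hK₀ : MeasurableSet K₀) (hK₀S : K₀ ⊆ S)
    {ε : ℝ≥0∞} (hε : ε ≠ 0) :
    ∃ K ⊆ K₀, IsCompact K ∧ μH[(d:ℝ)] K₀ ≤ μH[(d:ℝ)] K + ε ∧ ∃ δ > 0, ∀ x ∈ S, ∀ r ≤ δ, 0 < r →
      μH[(d:ℝ)] (K ∩ ball x r) ≤
        (L : ℝ≥0∞) ^ (2 * d) * (ENNReal.ofReal (r ^ d) * μH[(d:ℝ)] (ball (0 : Euc d) 1)) := by
  classical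
  obtain ⟨F, h1, h2, rfl⟩ := h
  have hcomp : ∀ P ∈ F, IsCompact P := fun P hP => (h1 P hP).1
  set Z : Set (Euc m) := ⋃ q ∈ F.offDiag, (q.1 ∩ q.2) with hZ
  have hZ0 : μH[(d:ℝ)] Z = 0 := by
    refine (measure_biUnion_null_iff (Finset.countable_toSet _)).2 fun q hq => ?_
    have hq' := Finset.mem_offDiag.1 hq
    exact h2 hq'.1 hq'.2.1 hq'.2.2
  have hZm : MeasurableSet Z := Finset.measurableSet_biUnion _ fun q hq =>
    ((hcomp _ (Finset.mem_offDiag.1 hq).1).measurableSet).inter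
      (hcomp _ (Finset.mem_offDiag.1 hq).2.1).measurableSet
  have hfin : IsFiniteMeasure ((μH[(d:ℝ)] : Measure (Euc m)).restrict (⋃ P ∈ F, P)) :=
    ⟨by simpa using hSfin⟩
  obtain ⟨K, hKsub, hK, hKε⟩ := (hK₀.diff hZm).exists_isCompact_lt_add
    (μ := (μH[(d:ℝ)] : Measure (Euc m)).restrict (⋃ P ∈ F, P)) (measure_ne_top _ _) hε
  rw [Measure.restrict_eq_self _ (sdiff_subset.trans hK₀S),
    Measure.restrict_eq_self _ (hKsub.trans (sdiff_subset.trans hK₀S)),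
    measure_sdiff_null hZ0] at hKε
  refine ⟨K, hKsub.trans sdiff_subset, hK, hKε.le, ?_⟩
  have hsep : ∀ q ∈ F.offDiag, ∃ δ > 0, Disjoint (thickening δ (K ∩ q.1)) (thickening δ q.2) := by
    intro q hq
    have hq' := Finset.mem_offDiag.1 hq
    refine Disjoint.exists_thickenings ?_ (hK.inter_right (hcomp _ hq'.1).isClosed)
      (hcomp _ hq'.2.1).isClosed
    rw [disjoint_left]
    rintro x ⟨hxK, hx1⟩ hx2
    exact (hKsub hxK).2 (mem_biUnion hq ⟨hx1, hx2⟩)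
  choose! δ hδ0 hδ using hsep
  obtain ⟨δ₀, hδ₀, hδ₀'⟩ : ∃ δ₀ > 0, ∀ q ∈ F.offDiag, δ₀ ≤ δ q := by
    have : ∀ᶠ t in 𝓝[>] (0:ℝ), ∀ q ∈ F.offDiag, t ≤ δ q :=
      (Filter.eventually_all_finset _).2 fun q hq =>
        mem_nhdsWithin_of_mem_nhds ((eventually_lt_nhds (hδ0 q hq)).mono fun _ => le_of_lt)
    obtain ⟨t, ht, ht'⟩ := (this.and self_mem_nhdsWithin).exists
    exact ⟨t, ht', ht⟩
  refine ⟨δ₀, hδ₀, fun x hx r hr hr0 => ?_⟩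
  obtain ⟨P, hP, hxP⟩ : ∃ P ∈ F, x ∈ P := by simpa using hx
  have hKP : K ∩ ball x r ⊆ P ∩ ball x r := by
    rintro y ⟨hyK, hyx⟩
    refine ⟨?_, hyx⟩
    by_contra hyP
    obtain ⟨Q, hQ, hyQ⟩ : ∃ Q ∈ F, y ∈ Q := by simpa using hK₀S (hKsub hyK).1
    have hq : (Q, P) ∈ F.offDiag :=
      Finset.mem_offDiag.2 ⟨hQ, hP, fun hQP : Q = P => hyP (hQP ▸ hyQ)⟩
    refine (disjoint_left.1 (hδ _ hq)) (self_subset_thickening (hδ0 _ hq) _ ⟨hyK, hyQ⟩) ?_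
    exact mem_thickening_iff.2 ⟨x, hxP, (mem_ball.1 hyx).trans_le (hr.trans (hδ₀' _ hq))⟩
  obtain ⟨φ, hφ⟩ := (h1 P hP).2
  have hL0 : (0:ℝ) < L := zero_lt_one.trans_le (by exact_mod_cast hL)
  calc μH[(d:ℝ)] (K ∩ ball x r) ≤ μH[(d:ℝ)] (P ∩ ball x r) := measure_mono hKP
    _ ≤ (L : ℝ≥0∞) ^ d * μH[(d:ℝ)] (φ '' (P ∩ ball x r)) :=
        (hφ.mono inter_subset_left).hausdorffMeasure_le
    _ ≤ (L : ℝ≥0∞) ^ d * μH[(d:ℝ)] (ball (φ x) (L * r)) := by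
        gcongr
        rintro _ ⟨y, ⟨hyP, hyx⟩, rfl⟩
        refine mem_ball.2 ((hφ.1.dist_le_mul _ hyP _ hxP).trans_lt ?_)
        exact mul_lt_mul_of_pos_left (mem_ball.1 hyx) hL0
    _ = _ := by
        rw [Measure.addHaar_ball_of_pos _ _ (by positivity), finrank_euclideanSpace_fin, mul_pow,
          ENNReal.ofReal_mul (by positivity), ENNReal.ofReal_pow hL0.le, ENNReal.ofReal_coe_nnreal,
          two_mul, pow_add]
        ring

lemma lintegral_ofReal_inv_Ioc {a b : ℝ} (ha : 0 < a) (hab : a ≤ b) :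
    ∫⁻ t in Ioc a b, ENNReal.ofReal t⁻¹ = ENNReal.ofReal (Real.log (b / a)) := by
  have hint : IntegrableOn (fun t : ℝ => t⁻¹) (Ioc a b) := by
    rw [← intervalIntegrable_iff_integrableOn_Ioc_of_le hab]
    refine intervalIntegral.intervalIntegrable_inv (fun t ht => ?_) continuousOn_id
    rw [uIcc_of_le hab] at ht
    exact (ha.trans_le ht.1).ne'
  rw [← integral_inv_of_pos ha (ha.trans_le hab), intervalIntegral.integral_of_le hab,
    ofReal_integral_eq_lintegral_ofReal hint]
  exact (ae_restrict_mem measurableSet_Ioc).mono fun t ht => (inv_pos.2 (ha.trans ht.1)).le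

lemma edist_rpow_neg_natCast {m d : ℕ} {x y : Euc m} (h : 0 < dist y x) :
    edist y x ^ (-(d:ℝ)) = ENNReal.ofReal (dist y x ^ d)⁻¹ := by
  rw [edist_dist, ENNReal.rpow_neg, ENNReal.rpow_natCast, ENNReal.ofReal_inv_of_pos (by positivity),
    ENNReal.ofReal_pow h.le]

lemma lt_inv_pow_iff {d : ℕ} (hd : d ≠ 0) {s t : ℝ} (hs : 0 < s) (ht : 0 < t) :
    t < (s ^ d)⁻¹ ↔ s < (t⁻¹) ^ ((d:ℝ)⁻¹) := by
  rw [Real.lt_rpow_inv_iff_of_pos hs.le (inv_pos.2 ht).le (by positivity), Real.rpow_natCast,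
    lt_inv_comm₀ ht (by positivity)]

/-- The potential of a measure with upper density bound `C`, truncated at distance `a`. -/
lemma lintegral_edist_rpow_neg_le {m d : ℕ} (hd : d ≠ 0) (μ : Measure (Euc m)) (x : Euc m)
    {a δ : ℝ} (ha : 0 < a) (haδ : a ≤ δ) {C : ℝ≥0∞}
    (hμ : ∀ r ≤ δ, 0 < r → μ (ball x r) ≤ C * ENNReal.ofReal (r ^ d)) :
    ∫⁻ y in (ball x a)ᶜ, edist y x ^ (-(d:ℝ)) ∂μ ≤
      μ univ * ENNReal.ofReal (δ ^ d)⁻¹ + C * ENNReal.ofReal (Real.log (δ ^ d / a ^ d)) := by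
  have hδ : 0 < δ := ha.trans_le haδ
  have hmem : ∀ {y : Euc m}, y ∈ (ball x a)ᶜ ↔ a ≤ dist y x := by simp
  have hmeas : MeasurableSet (ball x a)ᶜ := measurableSet_ball.compl
  rw [setLIntegral_congr_fun (g := fun y => ENNReal.ofReal (dist y x ^ d)⁻¹) hmeas
    (fun y hy => edist_rpow_neg_natCast (ha.trans_le (hmem.1 hy))),
    lintegral_eq_lintegral_meas_lt _ (Eventually.of_forall fun y => by positivity)
      (by fun_prop)]
  set ν := μ.restrict (ball x a)ᶜ with hν
  have hroot : ∀ t : ℝ, 0 < t → ((t⁻¹) ^ ((d:ℝ)⁻¹)) ^ d = t⁻¹ := fun t ht =>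
    Real.rpow_inv_natCast_pow (by positivity) hd
  have hab : (δ ^ d)⁻¹ ≤ (a ^ d)⁻¹ := by gcongr
  have hcover : Ioi (0:ℝ) ⊆ Ioc 0 (δ ^ d)⁻¹ ∪ (Ioc (δ ^ d)⁻¹ (a ^ d)⁻¹ ∪ Ioi (a ^ d)⁻¹) := by
    intro t ht
    rcases le_or_gt t (δ ^ d)⁻¹ with h | h
    · exact Or.inl ⟨ht, h⟩
    rcases le_or_gt t (a ^ d)⁻¹ with h' | h'
    exacts [Or.inr (Or.inl ⟨h, h'⟩), Or.inr (Or.inr h')]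
  have h1 : ∫⁻ t in Ioc 0 (δ ^ d)⁻¹, ν {y | t < (dist y x ^ d)⁻¹} ≤
      μ univ * ENNReal.ofReal (δ ^ d)⁻¹ := by
    calc _ ≤ ∫⁻ _ in Ioc 0 (δ ^ d)⁻¹, μ univ := lintegral_mono fun t =>
          (measure_mono (subset_univ _)).trans (Measure.restrict_apply_le _ _)
      _ = _ := by simp
  have h2 : ∫⁻ t in Ioc (δ ^ d)⁻¹ (a ^ d)⁻¹, ν {y | t < (dist y x ^ d)⁻¹} ≤
      C * ENNReal.ofReal (Real.log (δ ^ d / a ^ d)) := by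
    calc _ ≤ ∫⁻ t in Ioc (δ ^ d)⁻¹ (a ^ d)⁻¹, C * ENNReal.ofReal t⁻¹ := by
          refine setLIntegral_mono_ae (by fun_prop) (Eventually.of_forall fun t ht => ?_)
          have ht0 : 0 < t := (by positivity : 0 < (δ ^ d)⁻¹).trans ht.1
          rw [← hroot t ht0]
          refine le_trans ?_ (hμ _ ?_ (by positivity))
          · rw [hν, Measure.restrict_apply' hmeas]
            refine measure_mono fun y hy => ?_
            exact (lt_inv_pow_iff hd (ha.trans_le (hmem.1 hy.2)) ht0).1 hy.1
          · rw [Real.rpow_inv_le_iff_of_pos (by positivity) hδ.le (by positivity),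
              Real.rpow_natCast]
            exact inv_le_of_inv_le₀ (by positivity) ht.1.le
      _ = _ := by
          rw [lintegral_const_mul _ (by fun_prop), lintegral_ofReal_inv_Ioc (by positivity) hab,
            inv_div_inv]
  have h3 : ∫⁻ t in Ioi (a ^ d)⁻¹, ν {y | t < (dist y x ^ d)⁻¹} = 0 := by
    rw [setLIntegral_congr_fun (g := fun _ => 0) measurableSet_Ioi, lintegral_zero]
    intro t ht
    change ν _ = 0
    rw [hν, Measure.restrict_apply' hmeas]
    convert! measure_empty (μ := μ)
    refine eq_empty_of_forall_notMem fun y hy => ?_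
    have h4 : (dist y x ^ d)⁻¹ ≤ (a ^ d)⁻¹ := by
      have := hmem.1 hy.2
      gcongr
    exact absurd (hy.1.trans_le h4) (not_lt.2 (le_of_lt ht))
  calc _ ≤ _ := lintegral_mono_set hcover
    _ ≤ _ := lintegral_union_le _ _ _
    _ ≤ _ := add_le_add h1 ((lintegral_union_le _ _ _).trans (by rw [h3, add_zero]; exact h2))

/-- The truncated potential of `H_d` on a ball of `ℝ^d`. -/
lemma le_lintegral_edist_rpow_neg {d : ℕ} (hd : d ≠ 0) (y : Euc d) {a δ : ℝ} (ha : 0 < a)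
    (haδ : a ≤ δ) :
    μH[(d:ℝ)] (ball (0 : Euc d) 1) * ENNReal.ofReal (Real.log (δ ^ d / a ^ d)) ≤
      (∫⁻ w in ball y δ \ ball y a, edist w y ^ (-(d:ℝ)) ∂μH[(d:ℝ)]) +
        μH[(d:ℝ)] (ball (0 : Euc d) 1) := by
  set β := μH[(d:ℝ)] (ball (0 : Euc d) 1) with hβ
  have hδ : 0 < δ := ha.trans_le haδ
  have hball : ∀ r, 0 < r → μH[(d:ℝ)] (ball y r) = β * ENNReal.ofReal (r ^ d) := fun r hr => by
    rw [Measure.addHaar_ball_of_pos _ _ hr, finrank_euclideanSpace_fin, mul_comm]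
  have hmeas : MeasurableSet (ball y δ \ ball y a) := measurableSet_ball.diff measurableSet_ball
  have hmem : ∀ {w : Euc d}, w ∈ ball y δ \ ball y a ↔ dist w y < δ ∧ a ≤ dist w y := by simp
  rw [setLIntegral_congr_fun (g := fun w => ENNReal.ofReal (dist w y ^ d)⁻¹) hmeas
    (fun w hw => edist_rpow_neg_natCast (ha.trans_le (hmem.1 hw).2)),
    lintegral_eq_lintegral_meas_lt _ (Eventually.of_forall fun y => by positivity)
      (by fun_prop)]
  set ν := (μH[(d:ℝ)]).restrict (ball y δ \ ball y a) with hν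
  have hroot : ∀ t : ℝ, 0 < t → ((t⁻¹) ^ ((d:ℝ)⁻¹)) ^ d = t⁻¹ := fun t ht =>
    Real.rpow_inv_natCast_pow (by positivity) hd
  have hab : (δ ^ d)⁻¹ ≤ (a ^ d)⁻¹ := by gcongr
  have hδ' : 0 < (δ ^ d)⁻¹ := by positivity
  have key : ∀ t ∈ Ioc (δ ^ d)⁻¹ (a ^ d)⁻¹, β * ENNReal.ofReal t⁻¹ ≤
      ν {w | t < (dist w y ^ d)⁻¹} + β * ENNReal.ofReal (a ^ d) := fun t ht => by
    have ht0 : 0 < t := hδ'.trans ht.1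
    rw [← hroot t ht0, ← hball _ (by positivity), ← hball a ha, hν,
      Measure.restrict_apply' hmeas]
    refine (measure_mono fun w hw => ?_).trans (measure_union_le _ _)
    by_cases hwa : w ∈ ball y a
    · exact Or.inr hwa
    have hwa' : a ≤ dist w y := not_lt.1 hwa
    have h1 : t < (dist w y ^ d)⁻¹ := (lt_inv_pow_iff hd (ha.trans_le hwa') ht0).2 hw
    refine Or.inl ⟨h1, ?_, hwa⟩
    refine mem_ball.2 (lt_of_pow_lt_pow_left₀ d hδ.le ?_)
    exact (inv_lt_inv₀ (by positivity) (pow_pos (ha.trans_le hwa') _)).1 (ht.1.trans h1)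
  calc β * ENNReal.ofReal (Real.log (δ ^ d / a ^ d))
      = ∫⁻ t in Ioc (δ ^ d)⁻¹ (a ^ d)⁻¹, β * ENNReal.ofReal t⁻¹ := by
        rw [lintegral_const_mul _ (by fun_prop), lintegral_ofReal_inv_Ioc hδ' hab, inv_div_inv]
    _ ≤ ∫⁻ t in Ioc (δ ^ d)⁻¹ (a ^ d)⁻¹,
          (ν {w | t < (dist w y ^ d)⁻¹} + β * ENNReal.ofReal (a ^ d)) :=
        setLIntegral_mono' measurableSet_Ioc key
    _ = (∫⁻ t in Ioc (δ ^ d)⁻¹ (a ^ d)⁻¹, ν {w | t < (dist w y ^ d)⁻¹}) +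
          β * ENNReal.ofReal (a ^ d) * ENNReal.ofReal ((a ^ d)⁻¹ - (δ ^ d)⁻¹) := by
        rw [lintegral_add_right _ measurable_const]
        simp
    _ ≤ _ := by
        refine add_le_add (lintegral_mono_set fun t ht => hδ'.trans ht.1) ?_
        rw [mul_assoc, ← ENNReal.ofReal_mul (by positivity)]
        refine mul_le_of_le_one_right zero_le (ENNReal.ofReal_le_one.2 ?_)
        have h1 : a ^ d * (a ^ d)⁻¹ = 1 := mul_inv_cancel₀ (by positivity)
        have h2 : 0 < a ^ d := by positivity
        nlinarith [mul_pos h2 hδ']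

/-- Half-open cubes of a given `H_d`-measure `h ^ d` tile `ℝ^d`. -/
lemma exists_tiling {d : ℕ} (hd : 0 < d) :
    ∃ c > (0:ℝ), ∀ h > (0:ℝ), ∃ Q : (Fin d → ℤ) → Set (Euc d), (∀ z, MeasurableSet (Q z)) ∧
      Pairwise (Function.onFun Disjoint Q) ∧ (⋃ z, Q z) = univ ∧
      (∀ z, ∀ x ∈ Q z, ∀ y ∈ Q z, dist x y < c * h) ∧
      ∀ z, μH[(d:ℝ)] (Q z) = ENNReal.ofReal (h ^ d) := by
  obtain ⟨κ, hκ, hν⟩ : ∃ κ : ℝ≥0, 0 < κ ∧ (μH[(d:ℝ)] : Measure (Euc d)) = κ • volume :=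
    ⟨_, Measure.addHaarScalarFactor_pos_of_isAddHaarMeasure _ _,
      Measure.isAddLeftInvariant_eq_smul _ _⟩
  set k : ℝ := (κ:ℝ) ^ ((d:ℝ)⁻¹) with hk
  have hk0 : 0 < k := Real.rpow_pos_of_pos (by exact_mod_cast hκ) _
  have hkd : k ^ d = κ := Real.rpow_inv_natCast_pow κ.2 hd.ne'
  refine ⟨(d + 1) / k, by positivity, fun h hh => ?_⟩
  set s : ℝ := h / k with hs
  have hs0 : 0 < s := by positivity
  let Q : (Fin d → ℤ) → Set (Euc d) := fun z => {w | ∀ i, ⌊w i / s⌋ = z i}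
  have hQ : ∀ z, Q z = (WithLp.ofLp : Euc d → (Fin d → ℝ)) ⁻¹'
      (pi univ fun i => Ico (z i * s) ((z i + 1) * s)) := fun z => by
    ext w
    simp only [Q, mem_ofPred_eq, mem_preimage, Set.mem_pi, mem_univ, true_imp_iff, mem_Ico,
      Int.floor_eq_iff, le_div_iff₀ hs0, div_lt_iff₀ hs0]
  have hbox : ∀ z : Fin d → ℤ,
      MeasurableSet (pi univ fun i => Ico ((z i : ℝ) * s) ((z i + 1) * s)) :=
    fun z => MeasurableSet.univ_pi fun i => measurableSet_Ico
  refine ⟨Q, fun z => ?_, ?_, ?_, ?_, fun z => ?_⟩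
  · rw [hQ]
    exact (PiLp.volume_preserving_ofLp (Fin d)).measurable (hbox z)
  · intro z z' hzz'
    refine disjoint_left.2 fun w hw hw' => hzz' (funext fun i => ?_)
    rw [← hw i, ← hw' i]
  · exact eq_univ_of_forall fun w => mem_iUnion.2 ⟨fun i => ⌊w i / s⌋, fun i => rfl⟩
  · intro z x hx y hy
    have hi : ∀ i, dist (x i) (y i) ^ 2 ≤ s ^ 2 := fun i => by
      rw [hQ] at hx hy
      have hxi := hx i (mem_univ i)
      have hyi := hy i (mem_univ i)
      simp only [mem_Ico] at hxi hyi
      have : dist (x i) (y i) ≤ s := by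
        rw [Real.dist_eq, abs_le]
        constructor <;> linarith [hxi.1, hxi.2, hyi.1, hyi.2]
      gcongr
    have h1 : dist x y ≤ d * s := by
      rw [EuclideanSpace.dist_eq]
      refine Real.sqrt_le_iff.2 ⟨by positivity, ?_⟩
      calc ∑ i, dist (x i) (y i) ^ 2 ≤ ∑ _i : Fin d, s ^ 2 := Finset.sum_le_sum fun i _ => hi i
        _ = d * s ^ 2 := by simp
        _ ≤ (d * s) ^ 2 := by
          have : (1:ℝ) ≤ d := by exact_mod_cast hd
          rw [mul_pow]
          gcongr
          nlinarith
    calc dist x y ≤ d * s := h1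
      _ < (d + 1) * s := by linarith
      _ = _ := by rw [hs]; ring
  · rw [hQ, hν, Measure.smul_apply, (PiLp.volume_preserving_ofLp (Fin d)).measure_preimage
      (hbox z).nullMeasurableSet, Real.volume_pi_Ico]
    simp only [add_mul, one_mul, add_sub_cancel_left, Finset.prod_const, Finset.card_univ,
      Fintype.card_fin]
    rw [← ENNReal.ofReal_pow hs0.le, hs, div_pow, hkd, ENNReal.smul_def, smul_eq_mul,
      ← ENNReal.ofReal_coe_nnreal, ← ENNReal.ofReal_mul κ.coe_nonneg]
    congr 1
    field_simp

lemma exists_fin_config {α J : Type*} [Fintype J] {S : Set α} (hS : S.Nonempty) (x : J → α)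
    (hx : ∀ j, x j ∈ S) {N : ℕ} (hN : Fintype.card J ≤ N) :
    ∃ u : Fin N → α, (∀ i, u i ∈ S) ∧ ∀ g : α → ℝ≥0∞, ∑ j, g (x j) ≤ ∑ i, g (u i) := by
  classical
  obtain ⟨s, hs⟩ := hS
  obtain ⟨e⟩ : Nonempty (J ↪ Fin N) :=
    Function.Embedding.nonempty_of_card_le (by simpa using hN)
  refine ⟨Function.extend e x fun _ => s, fun i => ?_, fun g => ?_⟩
  · by_cases h : ∃ j, e j = i
    · obtain ⟨j, rfl⟩ := h
      rw [e.injective.extend_apply]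
      exact hx j
    · rw [Function.extend_apply' _ _ _ h]
      exact hs
  · calc ∑ j, g (x j) = ∑ j, g (Function.extend e x (fun _ => s) (e j)) := by
          simp only [e.injective.extend_apply]
      _ = ∑ i ∈ Finset.univ.map e, g (Function.extend e x (fun _ => s) i) := by
          rw [Finset.sum_map]
      _ ≤ _ := Finset.sum_le_sum_of_subset (Finset.subset_univ _)

lemma ofReal_inv_pow_mul_edist_rpow_neg_le {m n d : ℕ} {p q : Euc m} {r s : Euc n} {b : ℝ}
    (hb : 0 < b) (h : dist p q ≤ b * dist r s) :
    ENNReal.ofReal (b ^ d)⁻¹ * edist r s ^ (-(d:ℝ)) ≤ edist p q ^ (-(d:ℝ)) := by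
  have h1 : edist p q ≤ ENNReal.ofReal b * edist r s := by
    rw [edist_dist, edist_dist, ← ENNReal.ofReal_mul hb.le]
    exact ENNReal.ofReal_le_ofReal h
  have h2 : ENNReal.ofReal (b ^ d)⁻¹ = ENNReal.ofReal b ^ (-(d:ℝ)) := by
    rw [ENNReal.rpow_neg, ENNReal.rpow_natCast, ENNReal.ofReal_inv_of_pos (by positivity),
      ENNReal.ofReal_pow hb.le]
  rw [h2, ← ENNReal.mul_rpow_of_ne_top ENNReal.ofReal_ne_top (edist_ne_top _ _),
    ENNReal.rpow_neg, ENNReal.rpow_neg, ENNReal.inv_le_inv]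
  exact ENNReal.rpow_le_rpow h1 (by positivity)

lemma exists_mem_dist_le_of_small {α : Type*} [PseudoMetricSpace α] {S Q : Set α} {b : ℝ}
    (hS : S.Nonempty) (hb : 0 < b) (hQ : ∀ w ∈ Q, ∀ w' ∈ Q, dist w w' < b) {k : ℝ}
    (hk : k = 3 ∨ k = 1 ∧ (Q ∩ closure S).Nonempty) :
    ∃ x ∈ S, ∀ w ∈ Q, ∀ y ∈ S, dist y x ≤ k * (dist w y + 2 * b) := by
  by_cases hne : (Q ∩ closure S).Nonempty
  · obtain ⟨w₀, hw₀, hw₀S⟩ := hne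
    obtain ⟨x, hx, hwx⟩ := Metric.mem_closure_iff.1 hw₀S b hb
    refine ⟨x, hx, fun w hw y hy => ?_⟩
    have h1 : dist y x ≤ dist y w + dist w w₀ + dist w₀ x := dist_triangle4 _ _ _ _
    rw [dist_comm y w] at h1
    have h2 := hQ w hw w₀ hw₀
    have h3 : (1:ℝ) ≤ k := by rcases hk with rfl | ⟨rfl, -⟩ <;> norm_num
    have h4 : 0 ≤ dist w y := dist_nonneg
    nlinarith
  · have hk3 : k = 3 := hk.resolve_right fun h => hne h.2
    subst hk3
    rcases Q.eq_empty_or_nonempty with rfl | ⟨w₀, hw₀⟩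
    · obtain ⟨s, hs⟩ := hS
      exact ⟨s, hs, fun w hw => hw.elim⟩
    have hpos : 0 < infDist w₀ S :=
      (infDist_pos_iff_notMem_closure hS).1 fun h => hne ⟨w₀, hw₀, h⟩
    obtain ⟨x, hx, hwx⟩ := (infDist_lt_iff hS).1 (show infDist w₀ S < 2 * infDist w₀ S by linarith)
    refine ⟨x, hx, fun w hw y hy => ?_⟩
    have h1 : infDist w₀ S ≤ dist w₀ y := infDist_le_dist_of_mem hy
    have h2 : dist w₀ y ≤ dist w₀ w + dist w y := dist_triangle _ _ _
    have h3 : dist y x ≤ dist y w₀ + dist w₀ x := dist_triangle _ _ _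
    rw [dist_comm y w₀] at h3
    have h4 := hQ w₀ hw₀ w hw
    linarith

lemma sum_mul_measure_le {α ι : Type*} [MeasurableSpace α] (μ : Measure α) {Q : ι → Set α}
    (hQm : ∀ z, MeasurableSet (Q z)) (hQd : Pairwise (Function.onFun Disjoint Q)) (Z : Finset ι)
    {F G : Set α} (hG : ∀ z ∈ Z, Q z ⊆ G) {n : ℕ} {k : ι → ℕ}
    (hk : ∀ z, k z = n ∧ Disjoint (Q z) F ∨ k z = 1) :
    ∑ z ∈ Z, (k z : ℝ≥0∞) * μ (Q z) ≤ μ G + n * μ (G \ F) := by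
  classical
  have hsum : ∀ Z' ⊆ Z, ∑ z ∈ Z', μ (Q z) = μ (⋃ z ∈ Z', Q z) := fun Z' _ =>
    (measure_biUnion_finset (fun i _ j _ hij => hQd hij) fun z _ => hQm z).symm
  calc ∑ z ∈ Z, (k z : ℝ≥0∞) * μ (Q z)
      ≤ ∑ z ∈ Z, (μ (Q z) + if Disjoint (Q z) F then n * μ (Q z) else 0) := by
        refine Finset.sum_le_sum fun z _ => ?_
        rcases hk z with ⟨h, h'⟩ | h
        · rw [if_pos h', h]
          exact le_add_self
        · rw [h, Nat.cast_one, one_mul]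
          exact le_self_add
    _ = ∑ z ∈ Z, μ (Q z) + n * ∑ z ∈ Z with Disjoint (Q z) F, μ (Q z) := by
        rw [Finset.sum_add_distrib, ← Finset.sum_filter, Finset.mul_sum]
    _ ≤ μ G + n * μ (G \ F) := by
        rw [hsum _ subset_rfl, hsum _ (Finset.filter_subset _ _)]
        gcongr
        · exact iUnion₂_subset hG
        · refine iUnion₂_subset fun z hz w hw => ?_
          rw [Finset.mem_filter] at hz
          exact ⟨hG z hz.1 hw, disjoint_left.1 hz.2 hw⟩

lemma mul_setLIntegral_le_sum {α ι : Type*} [MeasurableSpace α] (μ : Measure α) {Q : ι → Set α}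
    (hQm : ∀ z, MeasurableSet (Q z)) (hQd : Pairwise (Function.onFun Disjoint Q)) (Z : Finset ι)
    {D E : Set α} (hE : MeasurableSet E) (hD : D ⊆ ⋃ z ∈ Z, Q z) {C t : ℝ≥0∞} (ht : t ≠ ∞)
    (hC : ∀ z, μ (Q z) ≤ C) {g : α → ℝ≥0∞} {v : ι → ℝ≥0∞}
    (hv : ∀ z, ∀ w ∈ Q z, w ∉ E → t * g w ≤ v z) :
    t * ∫⁻ w in D \ E, g w ∂μ ≤ C * ∑ z ∈ Z, v z := by
  have hsub : D \ E ⊆ ⋃ z ∈ Z, (Q z \ E) := fun w hw => by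
    obtain ⟨z, hz, hwz⟩ := mem_iUnion₂.1 (hD hw.1)
    exact mem_iUnion₂.2 ⟨z, hz, hwz, hw.2⟩
  rw [← lintegral_const_mul' _ _ ht, Finset.mul_sum]
  calc ∫⁻ w in D \ E, t * g w ∂μ ≤ ∫⁻ w in ⋃ z ∈ Z, (Q z \ E), t * g w ∂μ :=
        lintegral_mono_set hsub
    _ = ∑ z ∈ Z, ∫⁻ w in Q z \ E, t * g w ∂μ :=
        lintegral_biUnion_finset
          (fun i _ j _ hij => (hQd hij).mono sdiff_subset sdiff_subset)
          (fun z _ => (hQm z).diff hE) _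
    _ ≤ ∑ z ∈ Z, C * v z := by
        refine Finset.sum_le_sum fun z _ => ?_
        calc ∫⁻ w in Q z \ E, t * g w ∂μ ≤ ∫⁻ _w in Q z \ E, v z ∂μ :=
              setLIntegral_mono' ((hQm z).diff hE) fun w hw => hv z w hw.1 hw.2
          _ = v z * μ (Q z \ E) := setLIntegral_const _ _
          _ ≤ v z * C := by
              gcongr
              exact (measure_mono sdiff_subset).trans (hC z)
          _ = C * v z := mul_comm _ _

lemma exists_measure_cthickening_lt {d : ℕ} {F : Set (Euc d)} (hF : IsCompact F) {t : ℝ≥0∞}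
    (ht : μH[(d:ℝ)] F < t) : ∃ δ > 0, μH[(d:ℝ)] (cthickening δ F) < t := by
  have h1 := tendsto_measure_cthickening_of_isCompact (μ := (μH[(d:ℝ)] : Measure (Euc d))) hF
  have h2 : ∀ᶠ r in 𝓝[>] (0:ℝ), μH[(d:ℝ)] (cthickening r F) < t :=
    (h1.mono_left nhdsWithin_le_nhds).eventually (gt_mem_nhds ht)
  obtain ⟨δ, h, h'⟩ := (h2.and self_mem_nhdsWithin).exists
  exact ⟨δ, h', h⟩

/-- A well-distributed configuration on a bounded set `S ⊆ ℝ^d`: up to a factor close to `1`,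
the potential is at least `(N log N) β_d / T` on `S` for any `T > H_d (closure S)`. -/
lemma exists_config {d : ℕ} (hd : 0 < d) {S : Set (Euc d)} (hS : S.Nonempty)
    (hSb : Bornology.IsBounded S) {T : ℝ} (hT : μH[(d:ℝ)] (closure S) < ENNReal.ofReal T)
    {θ : ℝ} (hθ1 : θ < 1) :
    ∃ C : ℝ, ∀ᶠ N : ℕ in atTop, ∃ u : Fin N → Euc d, (∀ i, u i ∈ S) ∧ ∀ y ∈ S,
      ENNReal.ofReal (θ * (N / T)) * (μH[(d:ℝ)] (ball (0 : Euc d) 1) *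
        ENNReal.ofReal (Real.log N - C)) ≤ ∑ i, edist y (u i) ^ (-(d:ℝ)) := by
  classical
  obtain ⟨c, hc, htile⟩ := exists_tiling hd
  have hT0 : 0 < T := ENNReal.ofReal_pos.1 (bot_le.trans_lt hT)
  have hF : IsCompact (closure S) := hSb.isCompact_closure
  set F := closure S with hFdef
  obtain ⟨η, hη, hFη⟩ : ∃ η : ℝ≥0∞, 0 < η ∧ μH[(d:ℝ)] F + (1 + 3 ^ d) * η ≤ ENNReal.ofReal T := by
    refine ⟨(ENNReal.ofReal T - μH[(d:ℝ)] F) / (1 + 3 ^ d),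
      ENNReal.div_pos (tsub_pos_of_lt hT).ne' (by finiteness), ?_⟩
    rw [ENNReal.mul_div_cancel (by positivity) (by finiteness), add_tsub_cancel_of_le hT.le]
  obtain ⟨δ₂, hδ₂, hG⟩ := exists_measure_cthickening_lt hF
    (ENNReal.lt_add_right hF.measure_lt_top.ne hη.ne')
  set G := cthickening δ₂ F with hGdef
  obtain ⟨δ, hδ, rfl⟩ : ∃ δ > 0, δ₂ = 2 * δ := ⟨δ₂ / 2, by positivity, by ring⟩
  have hGF : μH[(d:ℝ)] (G \ F) ≤ η := by
    rw [measure_sdiff (self_subset_cthickening F) isClosed_closure.nullMeasurableSet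
      hF.measure_lt_top.ne]
    exact tsub_le_iff_left.2 hG.le
  obtain ⟨ρ, hρ, hρθ⟩ : ∃ ρ > 0, (1 + ρ) ^ d * θ ≤ 1 := by
    have h1 : Tendsto (fun ρ : ℝ => (1 + ρ) ^ d * θ) (𝓝[>] 0) (𝓝 θ) := by
      have : Continuous fun ρ : ℝ => (1 + ρ) ^ d * θ := by fun_prop
      have h2 := this.tendsto 0
      rw [add_zero, one_pow, one_mul] at h2
      exact h2.mono_left nhdsWithin_le_nhds
    obtain ⟨ρ, h, h'⟩ := ((h1.eventually (gt_mem_nhds hθ1)).and self_mem_nhdsWithin).exists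
    exact ⟨ρ, h', h.le⟩
  set κ : ℝ := δ ^ d / ((2 * c / ρ) ^ d * T) with hκ
  have hκ0 : 0 < κ := by positivity
  refine ⟨1 - Real.log κ, ?_⟩
  have hh0 : Tendsto (fun N : ℕ => (T / N) ^ ((d:ℝ)⁻¹)) atTop (𝓝 0) := by
    have h1 : Tendsto (fun N : ℕ => T / (N:ℝ)) atTop (𝓝 0) :=
      tendsto_const_div_atTop_nhds_zero_nat T
    have h2 := h1.rpow_const (p := (d:ℝ)⁻¹) (Or.inr (by positivity))
    rwa [Real.zero_rpow (by positivity)] at h2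
  have hev : ∀ t > 0, ∀ᶠ N : ℕ in atTop, t * (T / N) ^ ((d:ℝ)⁻¹) ≤ δ := fun t _ => by
    have h1 := hh0.const_mul t
    rw [mul_zero] at h1
    exact (h1.eventually (gt_mem_nhds hδ)).mono fun N h => h.le
  filter_upwards [hev c hc, hev (2 * c / ρ) (by positivity), eventually_gt_atTop 0]
    with N hN1 hN2 hN0
  have hN : (0:ℝ) < N := by exact_mod_cast hN0
  set h : ℝ := (T / N) ^ ((d:ℝ)⁻¹) with hh
  have hhpos : 0 < h := by positivity
  have hhd : h ^ d = T / N := Real.rpow_inv_natCast_pow (by positivity) hd.ne'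
  obtain ⟨Q, hQm, hQd, hQu, hQdiam, hQμ⟩ := htile h hhpos
  have hch : 0 < c * h := by positivity
  have hQG : ∀ z, (Q z ∩ thickening δ S).Nonempty → Q z ⊆ G := by
    rintro z ⟨w, hw, hwS⟩ w' hw'
    obtain ⟨s, hs, hsw⟩ := mem_thickening_iff.1 hwS
    refine mem_cthickening_of_dist_le w' s _ _ (subset_closure hs) ?_
    linarith [dist_triangle w' w s, hQdiam z w' hw' w hw]
  have hGfin : μH[(d:ℝ)] G ≠ ∞ := (hF.cthickening (r := 2 * δ)).measure_lt_top.ne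
  have hZfin : {z | (Q z ∩ thickening δ S).Nonempty}.Finite := by
    have h1 := Measure.finite_const_le_meas_of_disjoint_iUnion
      (μ := (μH[(d:ℝ)] : Measure (Euc d))) (As := fun z => Q z ∩ G)
      (ε := ENNReal.ofReal (h ^ d)) (by positivity)
      (fun z => (hQm z).inter isClosed_cthickening.measurableSet)
      (fun z z' hzz' => (hQd hzz').mono inter_subset_left inter_subset_left)
      (ne_top_of_le_ne_top hGfin (measure_mono (iUnion_subset fun z => inter_subset_right)))
    refine h1.subset fun z hz => ?_
    simp only [mem_ofPred_eq] at hz ⊢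
    rw [inter_eq_left.2 (hQG z hz), hQμ]
  set Z := hZfin.toFinset with hZ
  have hZmem : ∀ z, z ∈ Z ↔ (Q z ∩ thickening δ S).Nonempty := fun z => by
    rw [hZ, Set.Finite.mem_toFinset, mem_ofPred_eq]
  set k : (Fin d → ℤ) → ℕ := fun z => if (Q z ∩ F).Nonempty then 1 else 3 with hk
  have hk0 : ∀ z, 0 < k z := fun z => by simp only [hk]; split_ifs <;> norm_num
  choose x hxS hx using fun z => exists_mem_dist_le_of_small (Q := Q z) (k := k z) hS hch
    (hQdiam z) (by
      by_cases hne : (Q z ∩ F).Nonempty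
      · exact Or.inr ⟨by simp [hk, hne], hne⟩
      · exact Or.inl (by simp [hk, hne]))
  have hcard : ∑ z ∈ Z, k z ^ d ≤ N := by
    have h1 := sum_mul_measure_le (μH[(d:ℝ)] : Measure (Euc d)) hQm hQd Z (F := F) (G := G)
      (fun z hz => hQG z ((hZmem z).1 hz)) (n := 3 ^ d) (k := fun z => k z ^ d) (fun z => by
        by_cases hne : (Q z ∩ F).Nonempty
        · exact Or.inr (by simp [hk, hne])
        · exact Or.inl ⟨by simp [hk, hne], disjoint_iff_inter_eq_empty.2
            (not_nonempty_iff_eq_empty.1 hne)⟩)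
    have h2 : (∑ z ∈ Z, (k z ^ d : ℕ) : ℝ≥0∞) * ENNReal.ofReal (h ^ d) ≤ ENNReal.ofReal T := by
      rw [Finset.sum_mul]
      simp only [hQμ] at h1
      refine h1.trans (le_trans ?_ hFη)
      calc μH[(d:ℝ)] G + (3 ^ d : ℕ) * μH[(d:ℝ)] (G \ F)
          ≤ (μH[(d:ℝ)] F + η) + (3 ^ d : ℕ) * η := by gcongr
        _ = _ := by push_cast; ring
    rw [hhd, ← Nat.cast_sum, ← ENNReal.ofReal_natCast, ← ENNReal.ofReal_mul (by positivity),
      ENNReal.ofReal_le_ofReal_iff hT0.le] at h2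
    have h3 : ((∑ z ∈ Z, k z ^ d : ℕ) : ℝ) ≤ N := by
      rw [← mul_div_assoc, div_le_iff₀ hN, mul_comm T] at h2
      exact le_of_mul_le_mul_right h2 hT0
    exact_mod_cast h3
  obtain ⟨u, huS, hu⟩ := exists_fin_config (J := Σ z : Z, Fin (k z ^ d)) hS (fun j => x j.1)
    (fun j => hxS _) (N := N) (by
      simp only [Fintype.card_sigma, Fintype.card_fin]
      rwa [Finset.sum_coe_sort Z fun z => k z ^ d])
  refine ⟨u, huS, fun y hy => ?_⟩
  set a : ℝ := 2 * c / ρ * h with ha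
  have ha0 : 0 < a := by positivity
  have hsum : ∑ z ∈ Z, (k z ^ d : ℕ) * edist y (x z) ^ (-(d:ℝ)) ≤
      ∑ i, edist y (u i) ^ (-(d:ℝ)) := by
    refine le_trans (le_of_eq ?_) (hu fun p => edist y p ^ (-(d:ℝ)))
    rw [Fintype.sum_sigma]
    simp only [Finset.sum_const, Finset.card_univ, Fintype.card_fin, nsmul_eq_mul]
    rw [Finset.sum_coe_sort Z fun z => ((k z ^ d : ℕ) : ℝ≥0∞) * edist y (x z) ^ (-(d:ℝ))]
  have hball : ball y δ ⊆ ⋃ z ∈ Z, Q z := fun w hw => by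
    obtain ⟨z, hz⟩ := mem_iUnion.1 (hQu.symm ▸ mem_univ w : w ∈ ⋃ z, Q z)
    exact mem_iUnion₂.2 ⟨z, (hZmem z).2 ⟨w, hz, mem_thickening_iff.2 ⟨y, hy, hw⟩⟩, hz⟩
  have hcell : ∀ z, ∀ w ∈ Q z, w ∉ ball y a → ENNReal.ofReal θ * edist w y ^ (-(d:ℝ)) ≤
      (k z ^ d : ℕ) * edist y (x z) ^ (-(d:ℝ)) := fun z w hw hwa => by
    have hka : (0:ℝ) < k z := by exact_mod_cast hk0 z
    have h1 : a ≤ dist w y := not_lt.1 hwa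
    have h2 : 2 * (c * h) ≤ ρ * dist w y := by
      have : 2 * (c * h) = ρ * a := by rw [ha]; field_simp
      rw [this]
      gcongr
    have h3 : dist y (x z) ≤ (k z * (1 + ρ)) * dist w y := by
      refine (hx z w hw y hy).trans ?_
      rw [mul_assoc]
      gcongr
      linarith
    have h4 := ofReal_inv_pow_mul_edist_rpow_neg_le (d := d) (by positivity) h3
    calc ENNReal.ofReal θ * edist w y ^ (-(d:ℝ))
        ≤ (k z ^ d : ℕ) * (ENNReal.ofReal ((k z * (1 + ρ)) ^ d)⁻¹ * edist w y ^ (-(d:ℝ))) := by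
          rw [← mul_assoc, ← ENNReal.ofReal_natCast (k z ^ d), ← ENNReal.ofReal_mul (by positivity)]
          gcongr
          rw [mul_pow, mul_inv]
          push_cast
          rw [mul_inv_cancel_left₀ (by positivity), ← one_div, le_div_iff₀ (by positivity),
            mul_comm]
          exact hρθ
      _ ≤ _ := by gcongr
  have hint := mul_setLIntegral_le_sum (μH[(d:ℝ)] : Measure (Euc d)) hQm hQd Z
    (measurableSet_ball (x := y) (ε := a)) hball ENNReal.ofReal_ne_top (fun z => (hQμ z).le) hcell
  have hlog := le_lintegral_edist_rpow_neg hd.ne' y ha0 hN2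
  set I := ∫⁻ w in ball y δ \ ball y a, edist w y ^ (-(d:ℝ)) ∂μH[(d:ℝ)] with hI
  set β := μH[(d:ℝ)] (ball (0 : Euc d) 1) with hβ
  have hβfin : β ≠ ∞ := measure_ball_lt_top.ne
  have hLeq : Real.log N - (1 - Real.log κ) = Real.log (δ ^ d / a ^ d) - 1 := by
    have : δ ^ d / a ^ d = N * κ := by
      rw [ha, mul_pow, hhd, hκ]
      field_simp
    rw [this, Real.log_mul hN.ne' hκ0.ne']
    ring
  have hI' : β * ENNReal.ofReal (Real.log N - (1 - Real.log κ)) ≤ I := by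
    rw [hLeq, ENNReal.ofReal_sub _ zero_le_one, ENNReal.ofReal_one,
      ENNReal.mul_sub (fun _ _ => hβfin), mul_one]
    exact tsub_le_iff_right.2 hlog
  calc ENNReal.ofReal (θ * (N / T)) * (β * ENNReal.ofReal (Real.log N - (1 - Real.log κ)))
      ≤ ENNReal.ofReal (N / T) * (ENNReal.ofReal θ * I) := by
        rw [mul_comm θ, ENNReal.ofReal_mul (by positivity), mul_assoc]
        gcongr
    _ ≤ ENNReal.ofReal (N / T) * (ENNReal.ofReal (h ^ d) * ∑ i, edist y (u i) ^ (-(d:ℝ))) := by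
        exact mul_le_mul_right (hint.trans (mul_le_mul_right hsum _)) _
    _ = _ := by
        rw [← mul_assoc, ← ENNReal.ofReal_mul (by positivity), hhd,
          show (N:ℝ) / T * (T / N) = 1 by field_simp, ENNReal.ofReal_one, one_mul]

lemma eventually_mul_log_le {a b : ℝ} (hab : a < b) (c : ℝ) :
    ∀ᶠ N : ℕ in atTop, a * Real.log N + c ≤ b * Real.log N := by
  have h := (Real.tendsto_log_atTop.comp tendsto_natCast_atTop_atTop).eventually_ge_atTop
    (c / (b - a))
  filter_upwards [h] with N hN
  have h1 := (div_le_iff₀ (sub_pos.2 hab)).1 hN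
  simp only [Function.comp_apply] at h1
  linarith

/-- The lower bound for the polarization constant: `liminf M_N / (N log N) ≥ β_d / H_d(A)`. -/
lemma eventually_le_polarizationConst {d m : ℕ} (hd : 0 < d) {A : Set (Euc m)}
    (hA : A.Nonempty) (hfin : μH[(d:ℝ)] A ≠ ∞)
    (hflat : ∀ L : ℝ≥0, 1 < L → HasFlatPartition d L A) {q : ℝ} (hpos : μH[(d:ℝ)] A ≠ 0)
    (hq : q * (μH[(d:ℝ)] A).toReal < (μH[(d:ℝ)] (ball (0 : Euc d) 1)).toReal) :
    ∀ᶠ N : ℕ in atTop, ENNReal.ofReal (q * (N * Real.log N)) ≤ polarizationConst m A d N := by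
  set α := (μH[(d:ℝ)] A).toReal with hα
  set β := μH[(d:ℝ)] (ball (0 : Euc d) 1) with hβ
  have hβfin : β ≠ ∞ := measure_ball_lt_top.ne
  have hα0 : 0 < α := ENNReal.toReal_pos hpos hfin
  obtain ⟨L, hL1, hL⟩ : ∃ L : ℝ≥0, 1 < L ∧ q * α * L ^ (2 * d + 2) < β.toReal := by
    have h1 : Tendsto (fun L : ℝ≥0 => q * α * (L:ℝ) ^ (2 * d + 2)) (𝓝[>] 1) (𝓝 (q * α)) := by
      have : Continuous fun L : ℝ≥0 => q * α * (L:ℝ) ^ (2 * d + 2) := by fun_prop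
      have h2 := this.tendsto 1
      rw [NNReal.coe_one, one_pow, mul_one] at h2
      exact h2.mono_left nhdsWithin_le_nhds
    obtain ⟨L, h, h'⟩ := ((h1.eventually (gt_mem_nhds hq)).and self_mem_nhdsWithin).exists
    exact ⟨L, h', h⟩
  have hL0 : (0:ℝ) < L := by exact_mod_cast zero_lt_one.trans hL1
  have hL1' : (1:ℝ) < L := by exact_mod_cast hL1
  obtain ⟨Φ, hΦb, hΦμ, hΦ⟩ := (hflat L hL1).exists_expanding hd hL1.le
  set T : ℝ := L ^ (d + 1) * α with hT
  have hT0 : 0 < T := by positivity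
  have hΦT : μH[(d:ℝ)] (closure (Φ '' A)) < ENNReal.ofReal T := by
    refine hΦμ.trans_lt ?_
    rw [← ENNReal.ofReal_toReal hfin, ← ENNReal.ofReal_coe_nnreal, ← ENNReal.ofReal_pow hL0.le,
      ← ENNReal.ofReal_mul (by positivity), ENNReal.ofReal_lt_ofReal_iff hT0, hT, pow_succ]
    have : (L:ℝ) ^ d < L ^ d * L := lt_mul_of_one_lt_right (by positivity) hL1'
    exact mul_lt_mul_of_pos_right this hα0
  obtain ⟨C, hC⟩ := exists_config hd (hA.image Φ) hΦb hΦT (inv_lt_one_of_one_lt₀ hL1')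
  set q' : ℝ := ((L:ℝ) ^ d)⁻¹ * ((L:ℝ)⁻¹ / T * β.toReal) with hq'
  have hqq' : q < q' := by
    have : q' = β.toReal / (α * L ^ (2 * d + 2)) := by
      rw [hq', hT]
      field_simp
      ring
    rw [this, lt_div_iff₀ (by positivity), ← mul_assoc]
    exact hL
  filter_upwards [hC, eventually_mul_log_le hqq' (q' * C)] with N ⟨u, hu, huy⟩ hN
  choose x hxA hxu using hu
  refine le_iSup₂_of_le x hxA (le_iInf₂ fun y hy => ?_)
  calc ENNReal.ofReal (q * (N * Real.log N))
      ≤ ENNReal.ofReal (q' * N * (Real.log N - C)) := by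
        refine ENNReal.ofReal_le_ofReal ?_
        have : (0:ℝ) ≤ N := Nat.cast_nonneg N
        nlinarith
    _ = ENNReal.ofReal (L ^ d)⁻¹ * (ENNReal.ofReal ((L:ℝ)⁻¹ * (N / T)) *
          (β * ENNReal.ofReal (Real.log N - C))) := by
        rw [← ENNReal.ofReal_toReal hβfin, ← ENNReal.ofReal_mul ENNReal.toReal_nonneg,
          ← ENNReal.ofReal_mul (by positivity), ← ENNReal.ofReal_mul (by positivity),
          hq']
        congr 1
        field_simp
    _ ≤ ENNReal.ofReal (L ^ d)⁻¹ * ∑ i, edist (Φ y) (u i) ^ (-(d:ℝ)) := by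
        gcongr
        exact huy _ (mem_image_of_mem Φ hy)
    _ ≤ ∑ i, edist y (x i) ^ (-(d:ℝ)) := by
        rw [Finset.mul_sum]
        refine Finset.sum_le_sum fun i _ => ofReal_inv_pow_mul_edist_rpow_neg_le hL0 ?_
        rw [← hxu i]
        exact hΦ y hy _ (hxA i)

/-- If every ball of radius `r ≤ δ` centred in `A` has `H_d`-content at most `C r ^ d` in `K ⊆ A`,
then the polarization of `ω` on `A` is controlled by the number of points near `K`. -/
lemma polarization_mul_le {d m N : ℕ} (hd : d ≠ 0) {A K : Set (Euc m)} (hK : IsCompact K)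
    (hKA : K ⊆ A) {C : ℝ≥0∞} {δ : ℝ}
    (hC : ∀ x ∈ A, ∀ r ≤ δ, 0 < r → μH[(d:ℝ)] (K ∩ ball x r) ≤ C * ENNReal.ofReal (r ^ d))
    {ω : Fin N → Euc m} (hω : ∀ i, ω i ∈ A) {a : ℝ} (ha : 0 < a) (haδ : a ≤ δ) {n : ℕ}
    (hn : {i | (K ∩ ball (ω i) δ).Nonempty}.ncard ≤ n) :
    polarization ω A d * (μH[(d:ℝ)] K - N * (C * ENNReal.ofReal (a ^ d))) ≤
      N * (μH[(d:ℝ)] K * ENNReal.ofReal (δ ^ d)⁻¹) +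
        n * (C * ENNReal.ofReal (Real.log (δ ^ d / a ^ d))) := by
  classical
  set D := K \ ⋃ i, ball (ω i) a with hD
  have hKm : MeasurableSet K := hK.measurableSet
  have hDm : MeasurableSet D := hKm.diff (MeasurableSet.iUnion fun i => measurableSet_ball)
  have hDμ : μH[(d:ℝ)] K - N * (C * ENNReal.ofReal (a ^ d)) ≤ μH[(d:ℝ)] D := by
    refine tsub_le_iff_right.2 ?_
    calc μH[(d:ℝ)] K ≤ μH[(d:ℝ)] (D ∪ ⋃ i, K ∩ ball (ω i) a) := by
          refine measure_mono fun y hy => ?_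
          by_cases h : y ∈ ⋃ i, ball (ω i) a
          · obtain ⟨i, hi⟩ := mem_iUnion.1 h
            exact Or.inr (mem_iUnion.2 ⟨i, hy, hi⟩)
          · exact Or.inl ⟨hy, h⟩
      _ ≤ μH[(d:ℝ)] D + ∑ i, μH[(d:ℝ)] (K ∩ ball (ω i) a) :=
          (measure_union_le _ _).trans (by gcongr; exact measure_iUnion_fintype_le _ _)
      _ ≤ μH[(d:ℝ)] D + ∑ _i : Fin N, C * ENNReal.ofReal (a ^ d) := by
          gcongr with i
          exact hC _ (hω i) a haδ ha
      _ = _ := by simp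
  have hint : ∀ i, ∫⁻ y in D, edist y (ω i) ^ (-(d:ℝ)) ∂μH[(d:ℝ)] ≤
      μH[(d:ℝ)] K * ENNReal.ofReal (δ ^ d)⁻¹ + if (K ∩ ball (ω i) δ).Nonempty then
        C * ENNReal.ofReal (Real.log (δ ^ d / a ^ d)) else 0 := fun i => by
    set C' : ℝ≥0∞ := if (K ∩ ball (ω i) δ).Nonempty then C else 0 with hC'
    have h1 : ∀ r ≤ δ, 0 < r → (μH[(d:ℝ)] : Measure (Euc m)).restrict K (ball (ω i) r) ≤
        C' * ENNReal.ofReal (r ^ d) := fun r hr hr0 => by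
      rw [Measure.restrict_apply measurableSet_ball, inter_comm]
      by_cases h : (K ∩ ball (ω i) δ).Nonempty
      · rw [hC', if_pos h]
        exact hC _ (hω i) r hr hr0
      · have : K ∩ ball (ω i) r = ∅ := subset_empty_iff.1
          ((inter_subset_inter_right K (ball_subset_ball hr)).trans
            (not_nonempty_iff_eq_empty.1 h).subset)
        rw [this, measure_empty]
        exact zero_le
    have h2 := lintegral_edist_rpow_neg_le hd _ (ω i) ha haδ h1
    rw [Measure.restrict_restrict measurableSet_ball.compl, Measure.restrict_apply_univ,
      hC', ite_mul, zero_mul] at h2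
    have h3 : D ⊆ (ball (ω i) a)ᶜ ∩ K := fun y hy => ⟨fun h => hy.2 (mem_iUnion.2 ⟨i, h⟩), hy.1⟩
    exact (lintegral_mono_set h3).trans h2
  calc polarization ω A d * (μH[(d:ℝ)] K - N * (C * ENNReal.ofReal (a ^ d)))
      ≤ polarization ω A d * μH[(d:ℝ)] D := by gcongr
    _ = ∫⁻ _y in D, polarization ω A d ∂μH[(d:ℝ)] := (setLIntegral_const _ _).symm
    _ ≤ ∫⁻ y in D, ∑ i, edist y (ω i) ^ (-(d:ℝ)) ∂μH[(d:ℝ)] :=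
        setLIntegral_mono' hDm fun y hy => iInf₂_le y (hKA hy.1)
    _ = ∑ i, ∫⁻ y in D, edist y (ω i) ^ (-(d:ℝ)) ∂μH[(d:ℝ)] :=
        lintegral_finsetSum _ fun i _ => by fun_prop
    _ ≤ _ := Finset.sum_le_sum fun i _ => hint i
    _ = N * (μH[(d:ℝ)] K * ENNReal.ofReal (δ ^ d)⁻¹) +
        {i | (K ∩ ball (ω i) δ).Nonempty}.ncard *
          (C * ENNReal.ofReal (Real.log (δ ^ d / a ^ d))) := by
        rw [Finset.sum_add_distrib, ← Finset.sum_filter, Finset.sum_const, Finset.sum_const,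
          ncard_eq_toFinset_card']
        simp [nsmul_eq_mul]
    _ ≤ _ := by gcongr

lemma eventually_mul_le_ncard {d m : ℕ} (hd : d ≠ 0) {A K : Set (Euc m)} (hK : IsCompact K)
    (hKA : K ⊆ A) (hKfin : μH[(d:ℝ)] K ≠ ∞) {C δ : ℝ} (hC0 : 0 < C) (hδ : 0 < δ)
    (hC : ∀ x ∈ A, ∀ r ≤ δ, 0 < r →
      μH[(d:ℝ)] (K ∩ ball x r) ≤ ENNReal.ofReal C * ENNReal.ofReal (r ^ d))
    {ω : (N : ℕ) → Fin N → Euc m} (hω : ∀ N i, ω N i ∈ A) {q t : ℝ} (hq : 0 < q) (ht : 0 < t)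
    (hp : ∀ᶠ N : ℕ in atTop, ENNReal.ofReal (q * (N * Real.log N)) ≤ polarization (ω N) A d)
    (htq : t * C < q * (μH[(d:ℝ)] K).toReal) :
    ∀ᶠ N : ℕ in atTop, t * N ≤ {i | (K ∩ ball (ω N i) δ).Nonempty}.ncard := by
  set κ := (μH[(d:ℝ)] K).toReal with hκ
  obtain ⟨η, hη, hη'⟩ : ∃ η > 0, t * C < q * (κ - C * η) := by
    have h1 : Tendsto (fun η : ℝ => q * (κ - C * η)) (𝓝[>] 0) (𝓝 (q * κ)) := by
      have : Continuous fun η : ℝ => q * (κ - C * η) := by fun_prop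
      have h2 := this.tendsto 0
      rw [mul_zero, sub_zero] at h2
      exact h2.mono_left nhdsWithin_le_nhds
    obtain ⟨η, h, h'⟩ := ((h1.eventually (lt_mem_nhds htq)).and self_mem_nhdsWithin).exists
    exact ⟨η, h', h⟩
  have hκη : 0 < κ - C * η := pos_of_mul_pos_right ((mul_pos ht hC0).trans hη') hq.le
  have ha0 : Tendsto (fun N : ℕ => (η / N) ^ ((d:ℝ)⁻¹)) atTop (𝓝 0) := by
    have h1 : Tendsto (fun N : ℕ => η / (N:ℝ)) atTop (𝓝 0) :=
      tendsto_const_div_atTop_nhds_zero_nat η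
    have h2 := h1.rpow_const (p := (d:ℝ)⁻¹) (Or.inr (by positivity))
    rwa [Real.zero_rpow (by positivity)] at h2
  set c₀ := Real.log (δ ^ d / η) with hc₀
  filter_upwards [hp, ha0.eventually (gt_mem_nhds hδ), eventually_gt_atTop 0,
    eventually_mul_log_le hη' (κ * (δ ^ d)⁻¹ + t * C * c₀ + 1)] with N hpN haN hN0 hlog
  have hN : (0:ℝ) < N := by exact_mod_cast hN0
  set a : ℝ := (η / N) ^ ((d:ℝ)⁻¹) with ha
  have hapos : 0 < a := by positivity
  have had : a ^ d = η / N := Real.rpow_inv_natCast_pow (by positivity) hd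
  by_contra! hlt
  set n := {i | (K ∩ ball (ω N i) δ).Nonempty}.ncard with hn
  have hmain := polarization_mul_le hd hK hKA hC (hω N) hapos haN.le hn.symm.le
  have hℓ0 : 0 ≤ Real.log (δ ^ d / a ^ d) := by
    refine Real.log_nonneg ((one_le_div (by positivity)).2 ?_)
    gcongr
  have hℓ : Real.log (δ ^ d / a ^ d) = Real.log N + c₀ := by
    have : δ ^ d / a ^ d = N * (δ ^ d / η) := by
      rw [had]
      field_simp
    rw [this, Real.log_mul hN.ne' (by positivity)]
  have h2 : ENNReal.ofReal (q * (N * Real.log N)) * ENNReal.ofReal (κ - C * η) ≤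
      ENNReal.ofReal (N * (κ * (δ ^ d)⁻¹) + n * (C * Real.log (δ ^ d / a ^ d))) := by
    refine le_trans ?_ (hmain.trans (le_of_eq ?_))
    · refine mul_le_mul' hpN (le_of_eq ?_)
      rw [← ENNReal.ofReal_toReal hKfin, ← ENNReal.ofReal_natCast, ← ENNReal.ofReal_mul hC0.le,
        ← ENNReal.ofReal_mul hN.le, ← ENNReal.ofReal_sub _ (by positivity), had, ← hκ]
      congr 1
      field_simp
    · rw [← ENNReal.ofReal_toReal hKfin, ← ENNReal.ofReal_natCast, ← ENNReal.ofReal_natCast,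
        ← ENNReal.ofReal_mul ENNReal.toReal_nonneg, ← ENNReal.ofReal_mul hC0.le,
        ← ENNReal.ofReal_mul hN.le, ← ENNReal.ofReal_mul (Nat.cast_nonneg _),
        ← ENNReal.ofReal_add (by positivity) (by positivity)]
  rw [← ENNReal.ofReal_mul' hκη.le, ENNReal.ofReal_le_ofReal_iff (by positivity)] at h2
  have h3 : (n:ℝ) * (C * Real.log (δ ^ d / a ^ d)) ≤ t * N * (C * Real.log (δ ^ d / a ^ d)) := by
    gcongr
  rw [hℓ] at h2 h3
  have h4 : N * (q * (κ - C * η) * Real.log N) ≤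
      N * (κ * (δ ^ d)⁻¹ + t * C * (Real.log N + c₀)) := by linarith
  have h5 := le_of_mul_le_mul_left h4 hN
  linarith

lemma countingMeasure_apply {m N : ℕ} (ω : Fin N → Euc m) {E : Set (Euc m)}
    (hE : MeasurableSet E) : countingMeasure ω E = (N : ℝ≥0∞)⁻¹ * {i | ω i ∈ E}.ncard := by
  classical
  rw [countingMeasure, Measure.smul_apply, Measure.finsetSum_apply, smul_eq_mul,
    ncard_eq_toFinset_card']
  congr 1
  simp [Measure.dirac_apply' _ hE, indicator_apply, Finset.sum_boole]

/-- Asymptotically optimal configurations charge every open set at least as much as the normalized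
Hausdorff measure. -/
lemma eventually_mul_le_ncard_of_isOpen {d m : ℕ} (hd : 0 < d) {A : Set (Euc m)}
    (hA : IsCompact A) (hne : A.Nonempty) (hfin : μH[(d:ℝ)] A < ∞) (hpos : 0 < μH[(d:ℝ)] A)
    (hflat : ∀ L : ℝ≥0, 1 < L → HasFlatPartition d L A)
    {ω : (N : ℕ) → Fin N → Euc m} (hω : ∀ N i, ω N i ∈ A)
    (hopt : Tendsto (fun N : ℕ =>
        polarization (ω N) A (d : ℝ) / polarizationConst m A (d : ℝ) N) atTop (𝓝 1))
    {G : Set (Euc m)} (hG : IsOpen G) {t : ℝ} (ht : 0 < t)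
    (htG : t * (μH[(d:ℝ)] A).toReal < (μH[(d:ℝ)] (G ∩ A)).toReal) :
    ∀ᶠ N : ℕ in atTop, t * N ≤ {i | ω N i ∈ G}.ncard := by
  set α := (μH[(d:ℝ)] A).toReal with hα
  set κ₀ := (μH[(d:ℝ)] (G ∩ A)).toReal with hκ₀
  set β := μH[(d:ℝ)] (ball (0 : Euc d) 1) with hβ
  have hβfin : β ≠ ∞ := measure_ball_lt_top.ne
  set b := β.toReal with hb
  have hb0 : 0 < b := ENNReal.toReal_pos (measure_ball_pos _ _ zero_lt_one).ne' hβfin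
  have hα0 : 0 < α := ENNReal.toReal_pos hpos.ne' hfin.ne
  obtain ⟨L, hL1, hL⟩ : ∃ L : ℝ≥0, 1 < L ∧ t * α * L ^ (2 * d + 2) < κ₀ := by
    have h1 : Tendsto (fun L : ℝ≥0 => t * α * (L:ℝ) ^ (2 * d + 2)) (𝓝[>] 1) (𝓝 (t * α)) := by
      have : Continuous fun L : ℝ≥0 => t * α * (L:ℝ) ^ (2 * d + 2) := by fun_prop
      have h2 := this.tendsto 1
      rw [NNReal.coe_one, one_pow, mul_one] at h2
      exact h2.mono_left nhdsWithin_le_nhds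
    obtain ⟨L, h, h'⟩ := ((h1.eventually (gt_mem_nhds htG)).and self_mem_nhdsWithin).exists
    exact ⟨L, h', h⟩
  have hL0 : (0:ℝ) < L := by exact_mod_cast zero_lt_one.trans hL1
  have hL1' : (1:ℝ) < L := by exact_mod_cast hL1
  obtain ⟨ε, hε, hεL⟩ : ∃ ε > 0, t * α * L ^ (2 * d + 2) + ε < κ₀ :=
    ⟨(κ₀ - t * α * L ^ (2 * d + 2)) / 2, by linarith, by linarith⟩
  obtain ⟨K, hKGA, hK, hKε, δ₁, hδ₁, hδ⟩ :=
    (hflat L hL1).exists_compact_measure_inter_ball_le hL1.le hfin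
      (hG.measurableSet.inter hA.measurableSet) inter_subset_right
      (ENNReal.ofReal_pos.2 hε).ne'
  have hKfin : μH[(d:ℝ)] K ≠ ∞ :=
    ne_top_of_le_ne_top hfin.ne (measure_mono (hKGA.trans inter_subset_right))
  have hκ : t * α * L ^ (2 * d + 2) < (μH[(d:ℝ)] K).toReal := by
    have h1 := ENNReal.toReal_mono (by finiteness) hKε
    rw [ENNReal.toReal_add hKfin ENNReal.ofReal_ne_top, ENNReal.toReal_ofReal hε.le] at h1
    linarith
  obtain ⟨δ₂, hδ₂, hδG⟩ := hK.exists_thickening_subset_open hG (hKGA.trans inter_subset_left)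
  have hp : ∀ᶠ N : ℕ in atTop, ENNReal.ofReal (b / (α * L ^ 2) * (N * Real.log N)) ≤
      polarization (ω N) A d := by
    have h1 : ENNReal.ofReal (L:ℝ)⁻¹ < 1 := by
      rw [← ENNReal.ofReal_one, ENNReal.ofReal_lt_ofReal_iff one_pos]
      exact inv_lt_one_of_one_lt₀ hL1'
    have h2 : b / (α * L) * α < b := by
      rw [div_mul_eq_mul_div, div_lt_iff₀ (by positivity)]
      have : α < α * L := lt_mul_of_one_lt_right hα0 hL1'
      exact mul_lt_mul_of_pos_left this hb0
    filter_upwards [hopt.eventually (lt_mem_nhds h1),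
      eventually_le_polarizationConst hd hne hfin.ne hflat hpos.ne' h2] with N hN1 hN2
    refine le_trans ?_ (ENNReal.mul_le_of_le_div hN1.le)
    calc ENNReal.ofReal (b / (α * L ^ 2) * (N * Real.log N))
        = ENNReal.ofReal (L:ℝ)⁻¹ * ENNReal.ofReal (b / (α * L) * (N * Real.log N)) := by
          rw [← ENNReal.ofReal_mul (by positivity)]
          congr 1
          field_simp
      _ ≤ _ := by gcongr
  have hmain := eventually_mul_le_ncard hd.ne' hK (hKGA.trans inter_subset_right) hKfin
    (C := (L:ℝ) ^ (2 * d) * b) (δ := min δ₁ δ₂) (by positivity) (lt_min hδ₁ hδ₂)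
    (fun x hx r hr hr0 => by
      refine (hδ x hx r (hr.trans (min_le_left _ _)) hr0).trans (le_of_eq ?_)
      rw [ENNReal.ofReal_mul (by positivity), ENNReal.ofReal_pow hL0.le, ENNReal.ofReal_coe_nnreal,
        ENNReal.ofReal_toReal hβfin, mul_comm (ENNReal.ofReal (r ^ d)), mul_assoc])
    hω (by positivity) ht hp (by
      rw [div_mul_eq_mul_div, lt_div_iff₀ (by positivity)]
      calc t * (L ^ (2 * d) * b) * (α * L ^ 2) = b * (t * α * L ^ (2 * d + 2)) := by ring
        _ < _ := by gcongr)
  filter_upwards [hmain] with N hN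
  refine hN.trans ?_
  have hsub : {i | (K ∩ ball (ω N i) (min δ₁ δ₂)).Nonempty} ⊆ {i | ω N i ∈ G} := by
    rintro i ⟨y, hyK, hy⟩
    refine hδG (mem_thickening_iff.2 ⟨y, hyK, ?_⟩)
    rw [dist_comm]
    exact (mem_ball.1 hy).trans_le (min_le_right _ _)
  exact_mod_cast ncard_le_ncard hsub (toFinite _)

lemma tendsto_integral_countingMeasure {m : ℕ} {A : Set (Euc m)} (hA : IsCompact A)
    {ω : (N : ℕ) → Fin N → Euc m} (hω : ∀ N i, ω N i ∈ A) (μ : Measure (Euc m))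
    [IsProbabilityMeasure μ] (hμA : μ Aᶜ = 0)
    (h : ∀ G, IsOpen G → ∀ t : ℝ, 0 < t → ENNReal.ofReal t < μ G →
      ∀ᶠ N : ℕ in atTop, t * N ≤ {i | ω N i ∈ G}.ncard)
    {f : Euc m → ℝ} (hf : Continuous f) :
    Tendsto (fun N : ℕ => ∫ x, f x ∂(countingMeasure (ω N))) atTop (𝓝 (∫ x, f x ∂μ)) := by
  have hprob : ∀ N : ℕ, IsProbabilityMeasure (countingMeasure (ω (N + 1))) := fun N => ⟨by
    rw [countingMeasure_apply _ MeasurableSet.univ]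
    simp only [mem_univ, ofPred_true, ncard_univ, Nat.card_fin]
    exact ENNReal.inv_mul_cancel (by simp) (by finiteness)⟩
  let ν : ℕ → ProbabilityMeasure (Euc m) := fun N => ⟨countingMeasure (ω (N + 1)), hprob N⟩
  let ν' : ProbabilityMeasure (Euc m) := ⟨μ, inferInstance⟩
  have hlim : Tendsto ν atTop (𝓝 ν') := by
    refine tendsto_of_forall_isOpen_le_liminf' fun G hG => ?_
    refine le_of_forall_lt fun c hc => ?_
    obtain ⟨c', hcc', hc'⟩ := exists_between hc
    have hc'top : c' ≠ ∞ := (hc'.trans_le le_top).ne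
    refine hcc'.trans_le (le_liminf_of_le (by isBoundedDefault) ?_)
    have h1 := h G hG c'.toReal (ENNReal.toReal_pos (bot_le.trans_lt hcc').ne' hc'top)
      (by rwa [ENNReal.ofReal_toReal hc'top])
    filter_upwards [(tendsto_add_atTop_nat 1).eventually h1] with N hN
    change c' ≤ countingMeasure (ω (N + 1)) G
    rw [countingMeasure_apply _ hG.measurableSet, mul_comm, ← div_eq_mul_inv,
      ENNReal.le_div_iff_mul_le (Or.inl (by simp)) (Or.inl (by finiteness))]
    have h2 := ENNReal.ofReal_le_ofReal hN
    rwa [ENNReal.ofReal_mul ENNReal.toReal_nonneg, ENNReal.ofReal_toReal hc'top,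
      ENNReal.ofReal_natCast, ENNReal.ofReal_natCast] at h2
  obtain ⟨M, hM⟩ := hA.exists_bound_of_continuousOn hf.continuousOn
  let g : BoundedContinuousFunction (Euc m) ℝ :=
    .ofNormedAddCommGroup (fun x => max (-|M|) (min (f x) |M|)) (by fun_prop) |M| fun x => by
      rw [Real.norm_eq_abs, abs_le]
      exact ⟨le_max_left _ _, max_le (by linarith [abs_nonneg M]) (min_le_right _ _)⟩
  have hfg : ∀ x ∈ A, f x = g x := fun x hx => by
    have h1 := abs_le.1 ((hM x hx).trans (le_abs_self M))
    change f x = max (-|M|) (min (f x) |M|)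
    rw [min_eq_left h1.2, max_eq_right h1.1]
  have hint : ∀ ρ : Measure (Euc m), ρ Aᶜ = 0 → ∫ x, f x ∂ρ = ∫ x, g x ∂ρ := fun ρ hρ =>
    integral_congr_ae (Filter.mem_of_superset (mem_ae_iff.2 hρ) hfg)
  rw [← tendsto_add_atTop_iff_nat 1, hint μ hμA]
  have hcount : ∀ N : ℕ, ∫ x, f x ∂(countingMeasure (ω (N + 1))) =
      ∫ x, g x ∂(countingMeasure (ω (N + 1))) := fun N => hint _ (by
    rw [countingMeasure_apply _ hA.measurableSet.compl]
    simp [hω])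
  simp only [hcount]
  exact ProbabilityMeasure.tendsto_iff_forall_integral_tendsto.1 hlim g

/-- Theorem `bavv`, equidistribution: for `A = A_1 ∪ ⋯ ∪ A_l` infinite
with the usual hypotheses and `H_d(A) > 0`, every sequence of `N`-point configurations on
`A` that is asymptotically optimal for the `N`-point `d`-polarization problem on `A` has
normalized counting measures converging weak* to `H_d(·)|_A / H_d(A)`. -/
theorem statement2 (d m l : ℕ) (hd : 0 < d) (hdm : d ≤ m)
    (B : Fin l → Set (Euc m)) (A : Set (Euc m)) (hAeq : A = ⋃ i, B i)
    (hcomp : ∀ i, IsCompact (B i))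
    (hmani : ∀ i, ∃ W : Set (Euc m), IsC1EmbeddedManifold d m W ∧ B i ⊆ W)
    (hinter : ∀ i j : Fin l, i < j → μH[(d:ℝ)] (B i ∩ B j) = 0)
    (hinf : A.Infinite) (hpos : 0 < μH[(d:ℝ)] A)
    (ω : (N : ℕ) → Fin N → Euc m) (hω : ∀ N i, ω N i ∈ A)
    (hopt : Tendsto (fun N : ℕ =>
        polarization (ω N) A (d : ℝ) / polarizationConst m A (d : ℝ) N) atTop (𝓝 1)) :
    ∀ f : Euc m → ℝ, Continuous f →
      Tendsto (fun N : ℕ => ∫ x, f x ∂(countingMeasure (ω N))) atTop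
        (𝓝 (∫ x, f x ∂((μH[(d:ℝ)] A)⁻¹ • (μH[(d:ℝ)] : Measure (Euc m)).restrict A))) := by
  have hflat : ∀ L : ℝ≥0, 1 < L → HasFlatPartition d L A := fun L hL => by
    rw [hAeq]
    refine hasFlatPartition_iUnion B (fun i => ?_) hinter
    obtain ⟨W, hW, hBW⟩ := hmani i
    exact hW.hasFlatPartition (hcomp i) hBW hL
  have hA : IsCompact A := hAeq ▸ isCompact_iUnion hcomp
  have hfin : μH[(d:ℝ)] A < ∞ := by
    rw [hAeq]
    refine (measure_iUnion_fintype_le _ _).trans_lt (ENNReal.sum_lt_top.2 fun i _ => ?_)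
    obtain ⟨W, hW, hBW⟩ := hmani i
    exact hW.hausdorffMeasure_lt_top (hcomp i) hBW
  intro f hf
  have : IsProbabilityMeasure
      ((μH[(d:ℝ)] A)⁻¹ • (μH[(d:ℝ)] : Measure (Euc m)).restrict A) := ⟨by
    rw [Measure.smul_apply, Measure.restrict_apply_univ, smul_eq_mul,
      ENNReal.inv_mul_cancel hpos.ne' hfin.ne]⟩
  refine tendsto_integral_countingMeasure hA hω _ ?_ (fun G hG t ht htG => ?_) hf
  · rw [Measure.smul_apply, Measure.restrict_apply hA.measurableSet.compl, compl_inter_self,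
      measure_empty, smul_zero]
  · refine eventually_mul_le_ncard_of_isOpen hd hA hinf.nonempty hfin hpos hflat hω hopt hG ht ?_
    have hGfin : μH[(d:ℝ)] (G ∩ A) ≠ ∞ :=
      ne_top_of_le_ne_top hfin.ne (measure_mono inter_subset_right)
    rw [Measure.smul_apply, Measure.restrict_apply hG.measurableSet, smul_eq_mul, mul_comm,
      ← div_eq_mul_inv, ENNReal.lt_div_iff_mul_lt (Or.inl hpos.ne') (Or.inl hfin.ne)] at htG
    have h1 := ENNReal.toReal_strict_mono hGfin htG
    rwa [ENNReal.toReal_mul, ENNReal.toReal_ofReal ht.le] at h1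

end
end

section
/- Let 0 < R ≤ r, let d, m ∈ ℕ with d ≤ m, let D ⊂ ℝ^m be a compact set with H_d(D) < ∞, and let y ∈ D. Then ∫_{D \ B(y,R)} |x − y|^{−d} dH_d(x) ≤ r^{−d} H_d(D) + β_d · ᾱ_d(D;r) · d · ln(r/R). -/
open MeasureTheory Filter Set Metric
open scoped ENNReal NNReal Topology

noncomputable section

/-- The `d`-dimensional unit ball has positive volume. -/
theorem unitBallVol_ne_zero (d : ℕ) : unitBallVol d ≠ 0 :=
  (Metric.measure_ball_pos volume _ one_pos).ne'

/-- The `d`-dimensional unit ball has finite volume. -/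
theorem unitBallVol_ne_top (d : ℕ) : unitBallVol d ≠ ⊤ :=
  measure_ball_lt_top.ne

/-- The Hausdorff measure of a ball in `A` of radius `t ≤ ε` is at most `β_d ᾱ_d(A; ε) t^d`. -/
theorem hausdorffMeasure_closedBall_inter_le {m d : ℕ} {A : Set (Euc m)} {ε t : ℝ}
    (ht : 0 < t) (htε : t ≤ ε) {y : Euc m} (hy : y ∈ A) :
    μH[(d : ℝ)] (closedBall y t ∩ A) ≤ unitBallVol d * alphaBar d A ε * ENNReal.ofReal (t ^ d) := by
  have hle : μH[(d : ℝ)] (closedBall y t ∩ A) / (unitBallVol d * ENNReal.ofReal (t ^ d))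
      ≤ alphaBar d A ε :=
    le_iSup₂_of_le t ⟨ht, htε⟩ (le_iSup₂_of_le y hy le_rfl)
  have h0 : unitBallVol d * ENNReal.ofReal (t ^ d) ≠ 0 :=
    mul_ne_zero (unitBallVol_ne_zero d) (ENNReal.ofReal_pos.2 (pow_pos ht d)).ne'
  have h1 : unitBallVol d * ENNReal.ofReal (t ^ d) ≠ ⊤ :=
    ENNReal.mul_ne_top (unitBallVol_ne_top d) ENNReal.ofReal_ne_top
  rw [ENNReal.div_le_iff h0 h1] at hle
  exact hle.trans_eq (by ring)

/-- The lower Lebesgue integral over `(a, b]` of a nonnegative continuous function is its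
interval integral. -/
theorem lintegral_Ioc_ofReal_eq {f : ℝ → ℝ} {a b : ℝ} (hab : a ≤ b)
    (hf : ContinuousOn f (Icc a b)) (hf0 : ∀ t ∈ Ioc a b, 0 ≤ f t) :
    ∫⁻ t in Ioc a b, ENNReal.ofReal (f t) = ENNReal.ofReal (∫ t in a..b, f t) := by
  rw [intervalIntegral.integral_of_le hab, ofReal_integral_eq_lintegral_ofReal]
  · exact hf.integrableOn_Icc.mono_set Ioc_subset_Icc_self
  · exact (ae_restrict_iff' measurableSet_Ioc).2 (ae_of_all _ hf0)

/-- The identity `ρ^{-s} = r^{-s} + ∫_ρ^r s t^{-s-1} dt`. -/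
theorem ofReal_rpow_neg_eq_add_lintegral {s ρ r : ℝ} (hs : 0 < s) (hρ : 0 < ρ) (hρr : ρ ≤ r) :
    ENNReal.ofReal (ρ ^ (-s)) = ENNReal.ofReal (r ^ (-s))
      + ∫⁻ t in Ioc ρ r, ENNReal.ofReal (s * t ^ (-s - 1)) := by
  have hpos : ∀ t ∈ Icc ρ r, 0 < t := fun t ht => hρ.trans_le ht.1
  rw [lintegral_Ioc_ofReal_eq hρr]
  · have hint : ∫ t in ρ..r, s * t ^ (-s - 1) = ρ ^ (-s) - r ^ (-s) := by
      rw [intervalIntegral.integral_const_mul, integral_rpow]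
      · rw [sub_add_cancel]
        field_simp
        ring
      · refine Or.inr ⟨by linarith, ?_⟩
        rw [uIcc_of_le hρr]
        exact fun h => (hpos 0 h).false
    rw [hint, ← ENNReal.ofReal_add (Real.rpow_nonneg (hρ.le.trans hρr) _)
      (sub_nonneg.2 (Real.rpow_le_rpow_of_nonpos hρ hρr (by linarith)))]
    congr 1
    ring
  · exact continuousOn_const.mul (continuousOn_id.rpow_const fun t ht => Or.inl (hpos t ht).ne')
  · exact fun t ht => mul_nonneg hs.le (Real.rpow_nonneg (hpos t (Ioc_subset_Icc_self ht)).le _)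

/-- The integral of `s / t` over `(R, r]` is `s log (r / R)`. -/
theorem lintegral_Ioc_const_div {s R r : ℝ} (hs : 0 ≤ s) (hR : 0 < R) (hRr : R ≤ r) :
    ∫⁻ t in Ioc R r, ENNReal.ofReal (s * t⁻¹) = ENNReal.ofReal (s * Real.log (r / R)) := by
  have hpos : ∀ t ∈ Icc R r, 0 < t := fun t ht => hR.trans_le ht.1
  rw [lintegral_Ioc_ofReal_eq hRr]
  · rw [intervalIntegral.integral_const_mul, integral_inv_of_pos hR (hR.trans_le hRr)]
  · exact continuousOn_const.mul (continuousOn_id.inv₀ fun t ht => (hpos t ht).ne')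
  · exact fun t ht => mul_nonneg hs (inv_nonneg.2 (hpos t (Ioc_subset_Icc_self ht)).le)

/-- Outside the ball of radius `R`, the Riesz kernel is at most `r^{-s}` plus the integral of
`s t^{-s-1}` over those `t ∈ (R, r]` with `x ∈ B(y, t)`. -/
theorem edist_rpow_neg_le {X : Type*} [PseudoMetricSpace X] {s R r : ℝ} (hs : 0 < s) (hR : 0 < R)
    (hRr : R ≤ r) {x y : X} (hx : x ∉ closedBall y R) :
    edist x y ^ (-s) ≤ ENNReal.ofReal (r ^ (-s))
      + ∫⁻ t in Ioc R r,
          {p : X × ℝ | dist p.1 y ≤ p.2}.indicator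
            (fun p => ENNReal.ofReal (s * p.2 ^ (-s - 1))) (x, t) := by
  have hRx : R < dist x y := by simpa using hx
  have hx0 : 0 < dist x y := hR.trans hRx
  rw [edist_dist, ENNReal.ofReal_rpow_of_pos hx0]
  rcases le_total (dist x y) r with h | h
  · rw [ofReal_rpow_neg_eq_add_lintegral hs hx0 h]
    refine add_le_add le_rfl ?_
    calc ∫⁻ t in Ioc (dist x y) r, ENNReal.ofReal (s * t ^ (-s - 1))
        = ∫⁻ t in Ioc (dist x y) r, {p : X × ℝ | dist p.1 y ≤ p.2}.indicator
            (fun p => ENNReal.ofReal (s * p.2 ^ (-s - 1))) (x, t) :=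
          setLIntegral_congr_fun measurableSet_Ioc fun t ht => by
            rw [indicator_of_mem (show (x, t) ∈ {p : X × ℝ | dist p.1 y ≤ p.2} from ht.1.le)]
      _ ≤ _ := lintegral_mono_set (Ioc_subset_Ioc_left hRx.le)
  · refine le_add_right (ENNReal.ofReal_le_ofReal ?_)
    exact Real.rpow_le_rpow_of_nonpos (hR.trans_le hRr) h (by linarith)

/-- Lemma `add_up`: for `0 < R ≤ r`, `D ⊆ ℝ^m` compact with
`H_d(D) < ∞`, and `y ∈ D`,
`∫_{D \ B(y,R)} |x-y|^{-d} dH_d(x) ≤ r^{-d} H_d(D) + β_d ᾱ_d(D;r) d ln(r/R)`. -/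
theorem statement5 (d m : ℕ) (hd : 0 < d) (hdm : d ≤ m)
    (R r : ℝ) (hR : 0 < R) (hRr : R ≤ r)
    (D : Set (Euc m)) (hD : IsCompact D) (hfin : μH[(d:ℝ)] D < ⊤)
    (y : Euc m) (hy : y ∈ D) :
    ∫⁻ x in D \ Metric.closedBall y R, edist x y ^ (-(d:ℝ)) ∂μH[(d:ℝ)]
      ≤ ENNReal.ofReal (r ^ (-(d:ℝ))) * μH[(d:ℝ)] D
        + unitBallVol d * alphaBar d D r * ENNReal.ofReal ((d:ℝ) * Real.log (r / R)) := by
  have hs : (0 : ℝ) < d := by exact_mod_cast hd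
  set μ : Measure (Euc m) := μH[(d : ℝ)]
  set E : Set (Euc m) := D \ closedBall y R
  have hEm : MeasurableSet E := hD.measurableSet.diff isClosed_closedBall.measurableSet
  have hED : E ⊆ D := sdiff_subset
  have : IsFiniteMeasure (μ.restrict E) :=
    ⟨by rw [Measure.restrict_apply_univ]; exact (measure_mono hED).trans_lt hfin⟩
  let S : Set (Euc m × ℝ) := {p | dist p.1 y ≤ p.2}
  have hS : MeasurableSet S :=
    (isClosed_le (continuous_fst.dist continuous_const) continuous_snd).measurableSet
  let F : Euc m × ℝ → ℝ≥0∞ := S.indicator fun p => ENNReal.ofReal (d * p.2 ^ (-(d : ℝ) - 1))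
  have hF : Measurable F := Measurable.indicator (by fun_prop) hS
  have hslice : ∀ t ∈ Ioc R r, ∫⁻ x in E, F (x, t) ∂μ
      ≤ unitBallVol d * alphaBar d D r * ENNReal.ofReal (d * t⁻¹) := by
    intro t ht
    have ht0 : 0 < t := hR.trans ht.1
    have hFt : (fun x => F (x, t)) = (closedBall y t).indicator
        fun _ => ENNReal.ofReal (d * t ^ (-(d : ℝ) - 1)) := rfl
    rw [hFt, lintegral_indicator_const isClosed_closedBall.measurableSet,
      Measure.restrict_apply isClosed_closedBall.measurableSet]
    calc ENNReal.ofReal (d * t ^ (-(d : ℝ) - 1)) * μ (closedBall y t ∩ E)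
        ≤ ENNReal.ofReal (d * t ^ (-(d : ℝ) - 1))
            * (unitBallVol d * alphaBar d D r * ENNReal.ofReal (t ^ d)) := by
          gcongr
          exact (measure_mono (inter_subset_inter_right _ hED)).trans
            (hausdorffMeasure_closedBall_inter_le ht0 ht.2 hy)
      _ = unitBallVol d * alphaBar d D r
            * (ENNReal.ofReal (d * t ^ (-(d : ℝ) - 1)) * ENNReal.ofReal (t ^ d)) := by ring
      _ = unitBallVol d * alphaBar d D r * ENNReal.ofReal (d * t⁻¹) := by
          rw [← ENNReal.ofReal_mul (by positivity), mul_assoc (d : ℝ), ← Real.rpow_natCast t d,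
            ← Real.rpow_add ht0, show -(d : ℝ) - 1 + d = -1 by ring, Real.rpow_neg_one]
  calc ∫⁻ x in E, edist x y ^ (-(d : ℝ)) ∂μ
      ≤ ∫⁻ x in E, (ENNReal.ofReal (r ^ (-(d : ℝ))) + ∫⁻ t in Ioc R r, F (x, t)) ∂μ :=
        setLIntegral_mono' hEm fun x hx => edist_rpow_neg_le hs hR hRr hx.2
    _ = ENNReal.ofReal (r ^ (-(d : ℝ))) * μ E + ∫⁻ t in Ioc R r, ∫⁻ x in E, F (x, t) ∂μ := by
        rw [lintegral_add_left measurable_const, setLIntegral_const,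
          lintegral_lintegral_swap (f := fun x t => F (x, t)) hF.aemeasurable]
    _ ≤ ENNReal.ofReal (r ^ (-(d : ℝ))) * μ D
          + ∫⁻ t in Ioc R r, unitBallVol d * alphaBar d D r * ENNReal.ofReal (d * t⁻¹) := by
        gcongr ?_ + ?_
        · gcongr
        · exact setLIntegral_mono' measurableSet_Ioc hslice
    _ = _ := by
        rw [lintegral_const_mul _ (by fun_prop), lintegral_Ioc_const_div hs.le hR hRr]

end
end

section
/- Let U ⊂ ℝ^d be a non-empty open set and f : U → ℝ^m, m ≥ d, an injective C^1-continuous mapping such that its inverse f^{−1} : f(U) → U is continuous and the Jacobian matrix of f has rank d at every point of U. Then for every ε > 0 and every point y_0 ∈ f(U), there is a closed ball B in ℝ^m centered at y_0 such that the set B ∩ f(U) is bi-Lipschitz homeomorphic to some compact set in ℝ^d with constant 1 + ε. -/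
open MeasureTheory Filter Set Metric
open scoped ENNReal NNReal Topology

noncomputable section

/-- Orthogonal projection onto the range of a linear map of rank `d`, read in an orthonormal
basis: a norm-nonincreasing map to `ℝ^d` which is isometric on that range. -/
lemma exists_norm_le_and_isometric_on_range {d m : ℕ} (A : Euc d →L[ℝ] Euc m)
    (hA : LinearMap.rank A.toLinearMap = d) :
    ∃ P : Euc m →L[ℝ] Euc d, (∀ w, ‖P w‖ ≤ ‖w‖) ∧ ∀ v, ‖P (A v)‖ = ‖A v‖ := by
  have hfin : Module.finrank ℝ (LinearMap.range A.toLinearMap) = d :=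
    Module.finrank_eq_of_rank_eq hA
  let b := (stdOrthonormalBasis ℝ (LinearMap.range A.toLinearMap)).reindex (finCongr hfin)
  let Q := (LinearMap.range A.toLinearMap).orthogonalProjectionOnto
  refine ⟨(b.repr.toContinuousLinearEquiv : _ →L[ℝ] Euc d) ∘L Q, fun w => ?_, fun v => ?_⟩
  · exact (b.repr.norm_map (Q w)).trans_le
      (Submodule.norm_orthogonalProjectionOnto_apply_le _ w)
  · have h : Q (A v) = ⟨A v, LinearMap.mem_range_self A.toLinearMap v⟩ :=
      Submodule.orthogonalProjectionOnto_mem_subspace_eq_self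
        (⟨A v, LinearMap.mem_range_self A.toLinearMap v⟩ : LinearMap.range A.toLinearMap)
    exact (b.repr.norm_map (Q (A v))).trans (by rw [h]; rfl)

/-- A linear map on `ℝ^d` of rank `d` is bounded below. -/
lemma exists_pos_mul_norm_le {d m : ℕ} (A : Euc d →L[ℝ] Euc m)
    (hA : LinearMap.rank A.toLinearMap = d) :
    ∃ k : ℝ, 0 < k ∧ ∀ v, k * ‖v‖ ≤ ‖A v‖ := by
  have hfin : Module.finrank ℝ (LinearMap.range A.toLinearMap) = d :=
    Module.finrank_eq_of_rank_eq hA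
  have hker : LinearMap.ker A.toLinearMap = ⊥ := by
    have h := LinearMap.finrank_range_add_finrank_ker A.toLinearMap
    rw [hfin, finrank_euclideanSpace_fin] at h
    exact Submodule.finrank_eq_zero.mp (by omega)
  obtain ⟨K, hK, hanti⟩ := A.toLinearMap.exists_antilipschitzWith hker
  refine ⟨(K : ℝ)⁻¹, by positivity, fun v => ?_⟩
  rw [inv_mul_le_iff₀ (by exact_mod_cast hK)]
  simpa using hanti.le_mul_dist v 0

/-- Near a point where `f` is strictly differentiable with derivative of rank `d`, some linear
map to `ℝ^d` is almost isometric on the image of `f`. -/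
lemma HasStrictFDerivAt.exists_almost_isometric {d m : ℕ} {f : Euc d → Euc m}
    {A : Euc d →L[ℝ] Euc m} {x₀ : Euc d} (hf : HasStrictFDerivAt f A x₀)
    (hA : LinearMap.rank A.toLinearMap = d) {ε : ℝ} (hε : 0 < ε) :
    ∃ P : Euc m →L[ℝ] Euc d, ∃ s ∈ 𝓝 x₀, ∀ x ∈ s, ∀ y ∈ s,
      (1 + ε)⁻¹ * dist (f x) (f y) ≤ dist (P (f x)) (P (f y)) ∧
      dist (P (f x)) (P (f y)) ≤ (1 + ε) * dist (f x) (f y) := by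
  obtain ⟨P, hP, hPA⟩ := exists_norm_le_and_isometric_on_range A hA
  obtain ⟨k, hk, hkA⟩ := exists_pos_mul_norm_le A hA
  let c : ℝ≥0 := ⟨ε * k / (2 + ε), by positivity⟩
  have hc : (c : ℝ) * (2 + ε) = ε * k := div_mul_cancel₀ _ (by positivity)
  obtain ⟨s, hs, happ⟩ := hf.approximates_deriv_on_nhds (c := c)
    (Or.inr (NNReal.coe_pos.mp (by change (0 : ℝ) < ε * k / (2 + ε); positivity)))
  refine ⟨P, s, hs, fun x hx y hy => ?_⟩
  have he := happ x hx y hy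
  set e := f x - f y - A (x - y) with hedef
  have hfe : f x - f y = A (x - y) + e := by rw [hedef]; abel
  rw [dist_eq_norm, dist_eq_norm, ← map_sub]
  refine ⟨?_, (hP _).trans (le_mul_of_one_le_left (norm_nonneg _) (by linarith))⟩
  rw [inv_mul_le_iff₀ (by positivity)]
  have hup : ‖f x - f y‖ ≤ ‖A (x - y)‖ + c * ‖x - y‖ := by
    rw [hfe]
    exact (norm_add_le _ _).trans (by gcongr)
  have hlow : ‖A (x - y)‖ - c * ‖x - y‖ ≤ ‖P (f x - f y)‖ := by
    have h := norm_sub_le (P (f x - f y)) (P e)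
    rw [← map_sub, hfe, add_sub_cancel_right, hPA] at h
    rw [hfe]
    linarith [hP e]
  have hbelow := mul_le_mul_of_nonneg_left (hkA (x - y)) hε.le
  have hct : (c : ℝ) * ‖x - y‖ * (2 + ε) = ε * (k * ‖x - y‖) := by
    rw [mul_right_comm, hc]; ring
  calc ‖f x - f y‖ ≤ ‖A (x - y)‖ + c * ‖x - y‖ := hup
    _ ≤ (1 + ε) * (‖A (x - y)‖ - c * ‖x - y‖) := by linarith
    _ ≤ (1 + ε) * ‖P (f x - f y)‖ := by gcongr

/-- Lemma `lemma1`: let `U ⊆ ℝ^d` be nonempty open and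
`f : U → ℝ^m` (`m ≥ d`) an injective `C¹`-map with continuous inverse
`g : f(U) → U` whose Jacobian has rank `d` at every point of `U`. Then for every
`ε > 0` and `y₀ ∈ f(U)` there is a closed ball `B` centered at `y₀` such that
`B ∩ f(U)` is bi-Lipschitz homeomorphic to a compact set in `ℝ^d` with constant `1+ε`. -/
theorem statement10 (d m : ℕ) (hd : 0 < d) (hdm : d ≤ m)
    (U : Set (Euc d)) (hUne : U.Nonempty) (hU : IsOpen U)
    (f : Euc d → Euc m) (hinj : Set.InjOn f U) (hf : ContDiffOn ℝ 1 f U)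
    (g : Euc m → Euc d) (hg : ContinuousOn g (f '' U)) (hgf : Set.LeftInvOn g f U)
    (hrank : ∀ x ∈ U, LinearMap.rank (fderiv ℝ f x).toLinearMap = d)
    (ε : ℝ) (hε : 0 < ε) (y₀ : Euc m) (hy₀ : y₀ ∈ f '' U) :
    ∃ ρ : ℝ, 0 < ρ ∧ ∃ D : Set (Euc d), IsCompact D ∧
      IsBiLipschitzHomeoWith (1 + ε) (Metric.closedBall y₀ ρ ∩ f '' U) D := by
  obtain ⟨x₀, hx₀, rfl⟩ := hy₀
  have hstrict : HasStrictFDerivAt f (fderiv ℝ f x₀) x₀ :=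
    (hf.contDiffAt (hU.mem_nhds hx₀)).hasStrictFDerivAt one_ne_zero
  obtain ⟨P, s, hs, hPs⟩ := hstrict.exists_almost_isometric (hrank x₀ hx₀) hε
  obtain ⟨r, hr, hrs⟩ := Metric.nhds_basis_closedBall.mem_iff.mp
    (Filter.inter_mem hs (hU.mem_nhds hx₀))
  have hgK : g ⁻¹' closedBall x₀ r ∈ 𝓝[f '' U] f x₀ :=
    hg (f x₀) (mem_image_of_mem f hx₀) (by rw [hgf hx₀]; exact closedBall_mem_nhds x₀ hr)
  obtain ⟨ρ, hρ, hρg⟩ :=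
    (nhdsWithin_hasBasis Metric.nhds_basis_closedBall (f '' U)).mem_iff.mp hgK
  have hmem : ∀ x ∈ U, f x ∈ closedBall (f x₀) ρ → x ∈ closedBall x₀ r := fun x hx hfx => by
    simpa [hgf hx] using hρg ⟨hfx, mem_image_of_mem f hx⟩
  have heq : closedBall (f x₀) ρ ∩ f '' U = closedBall (f x₀) ρ ∩ f '' closedBall x₀ r := by
    ext y
    constructor
    · rintro ⟨hy, x, hx, rfl⟩
      exact ⟨hy, mem_image_of_mem f (hmem x hx hy)⟩
    · rintro ⟨hy, x, hx, rfl⟩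
      exact ⟨hy, mem_image_of_mem f (hrs hx).2⟩
  have hcompact : IsCompact (closedBall (f x₀) ρ ∩ f '' U) := by
    rw [heq]
    exact ((isCompact_closedBall x₀ r).image_of_continuousOn
      (hf.continuousOn.mono fun x hx => (hrs hx).2)).inter_left isClosed_closedBall
  refine ⟨ρ, hρ, _, hcompact.image P.continuous, P, rfl, ?_⟩
  rintro _ ⟨hx, x, hxU, rfl⟩ _ ⟨hy, y, hyU, rfl⟩
  exact hPs x (hrs (hmem x hxU hx)).1 y (hrs (hmem y hyU hy)).1

end
end
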